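/- arXiv:1710.00402 — 2 statements merged into one kernel-verified Lean document; each statement's English description precedes it below -/
import Mathlib

section
/- Let P be a simplicial poset with maximal ideal m = (x₁,...,xₙ) in A = k[x₁,...,xₙ]. If α ∈ ℤⁿ has αⱼ > 0 for some j, then the local cohomology H_m^i(A_P)_α = 0 for all i. If αᵢ ≤ 0 for all i, then H_m^i(A_P)_α ≅ ⊕_{w : supp(w) = supp(α)} H̃^{i − |supp(α)| − 1}(lk_P(w)), the direct sum over faces w of P whose support equals supp(α) = {i : αᵢ ≠ 0}. -/
open scoped Classical
open MvPolynomial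

noncomputable section

def IsSimplicialPoset (P : Type*) [Fintype P] [PartialOrder P] [OrderBot P] : Prop :=
  ∀ y : P, ∃ m : ℕ, Nonempty (Set.Icc (⊥ : P) y ≃o Finset (Fin m))

def MUB {P : Type*} [PartialOrder P] (w y : P) : Set P :=
  {z | z ∈ upperBounds {w, y} ∧ ∀ z' ∈ upperBounds {w, y}, z' ≤ z → z' = z}

variable (P : Type) [Fintype P] [PartialOrder P] [OrderBot P]
variable (k : Type) [Field k]

/-- The defining ideal of the face ring of a simplicial poset. -/
def faceIdeal : Ideal (MvPolynomial P k) :=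
  Ideal.span
    ({f | ∃ w y : P, upperBounds {w, y} = ∅ ∧ f = X w * X y} ∪
     {f | ∃ w y m : P, (upperBounds {w, y}).Nonempty ∧ IsGLB {w, y} m ∧
        f = X w * X y - X m * ∑ z ∈ (Set.toFinite (MUB w y)).toFinset, X z} ∪
     {X (⊥ : P) - 1})

/-- The face ring `A_P = k[P]/I_P` of a simplicial poset. -/
abbrev FaceRing := MvPolynomial P k ⧸ faceIdeal P k

/-- The class of the variable corresponding to a face `y` in the face ring. -/
def fv (y : P) : FaceRing P k := Ideal.Quotient.mk _ (X y)

/-- `r` is a standard monomial with leading variable `z`: a product of powers of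
variables along a strictly decreasing chain starting at `z`, with positive exponents. -/
def IsStdMonLead (r : FaceRing P k) (z : P) : Prop :=
  ∃ (c : ℕ) (w : Fin (c + 1) → P) (p : Fin (c + 1) → ℕ),
    StrictAnti w ∧ (∀ i, 0 < p i) ∧ w 0 = z ∧ r = ∏ i, (fv P k (w i)) ^ (p i)

variable (n : ℕ) (x : Fin n → P)

/-- The ℤⁿ-graded piece of the face ring of degree `α`, with respect to the atom
labelling `x : Fin n → P`: the span of (classes of) monomials of `k[P]` whose
ℤⁿ-degree (each face `y` contributing `e_i` for every atom `x i ≤ y`) is `α`. -/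
def facePiece (α : Fin n → ℤ) : Submodule k (FaceRing P k) :=
  Submodule.span k
    {r | ∃ σ : P →₀ ℕ,
      (∀ j : Fin n, (∑ y ∈ σ.support, if x j ≤ y then (σ y : ℤ) else 0) = α j) ∧
      r = Ideal.Quotient.mk _ (monomial σ (1 : k))}

/-- Cochains of the complex `Hom_A(K_•^ℓ, A_P)`: a free basis of `K_t^ℓ` is indexed by
`t`-subsets of `Fin n`, so `Hom_A(K_t^ℓ, A_P)` is identified with functions from
`t`-subsets to `A_P`; we take functions on all finite subsets at once. -/
abbrev KCochain := Finset (Fin n) → FaceRing P k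

/-- The differential of `Hom_A(K_•^ℓ, A_P)`:
`(df)(G) = Σ_{j ∈ G} (-1)^{|{i ∈ G : i < j}|} x_j^ℓ · f(G \ {j})`. -/
def koszulD (ℓ : ℕ) : KCochain P k n →ₗ[k] KCochain P k n :=
  LinearMap.pi fun G =>
    ∑ j ∈ G, ((-1 : k) ^ ((G.filter fun i => i < j).card)) •
      ((LinearMap.mulLeft k ((fv P k (x j)) ^ ℓ)).comp (LinearMap.proj (G.erase j)))

/-- The degree-`(t, α)` graded piece of the Koszul cochains: functions supported on
`t`-subsets `G`, with value at `G` in the graded piece of degree `α + ℓ·χ_G`. -/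
def gradedKC (ℓ t : ℕ) (α : Fin n → ℤ) : Submodule k (KCochain P k n) :=
  Submodule.pi Set.univ fun G =>
    if G.card = t then facePiece P k n x (fun j => α j + if j ∈ G then (ℓ : ℤ) else 0)
    else ⊥

/-- Cocycles of degree `(t, α)`. -/
def ZK (ℓ t : ℕ) (α : Fin n → ℤ) : Submodule k (KCochain P k n) :=
  LinearMap.ker (koszulD P k n x ℓ) ⊓ gradedKC P k n x ℓ t α

/-- Coboundaries of degree `(t, α)`. -/
def BK (ℓ t : ℕ) (α : Fin n → ℤ) : Submodule k (KCochain P k n) :=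
  Submodule.map (koszulD P k n x ℓ) (gradedKC P k n x ℓ (t - 1) α)

/-- The graded piece `Ext_A^t(A/m_ℓ, A_P)_α`, computed as degree-`(t,α)` cohomology
of the complex `Hom_A(K_•^ℓ, A_P)`. -/
abbrev ExtPiece (ℓ t : ℕ) (α : Fin n → ℤ) :=
  ↥(ZK P k n x ℓ t α) ⧸
    Submodule.comap (ZK P k n x ℓ t α).subtype (BK P k n x ℓ t α)


/-- The cochain-level map `π̂^* : Hom_A(K_•^ℓ, A_P) → Hom_A(K_•^{ℓ+1}, A_P)` induced by
the comparison `π̂ : K_•^{ℓ+1} → K_•^ℓ` of Koszul complexes covering the projection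
`A/m_{ℓ+1} → A/m_ℓ`: `(π̂^* f)(F) = (∏_{j ∈ F} x_j) · f(F)`. -/
def transKC : KCochain P k n →ₗ[k] KCochain P k n :=
  LinearMap.pi fun G =>
    (LinearMap.mulLeft k (∏ j ∈ G, fv P k (x j))).comp (LinearMap.proj G)

set_option synthInstance.maxHeartbeats 1000000 in
/-- The transition map `Ext_A^t(A/m_ℓ, A_P)_α → Ext_A^t(A/m_{ℓ+1}, A_P)_α` induced by
`π̂^*` (the structure map of the directed system computing local cohomology). -/
def transExt (ℓ t : ℕ) (α : Fin n → ℤ) :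
    ExtPiece P k n x ℓ t α →ₗ[k] ExtPiece P k n x (ℓ + 1) t α := by
  classical
  exact if h : ∃ g : ↥(ZK P k n x ℓ t α) →ₗ[k] ↥(ZK P k n x (ℓ + 1) t α),
      (∀ v : ↥(ZK P k n x ℓ t α),
        (g v : KCochain P k n) = transKC P k n x (v : KCochain P k n)) ∧
      Submodule.comap (ZK P k n x ℓ t α).subtype (BK P k n x ℓ t α) ≤
        (Submodule.comap (ZK P k n x (ℓ + 1) t α).subtype
          (BK P k n x (ℓ + 1) t α)).comap g
  then Submodule.mapQ _ _ h.choose h.choose_spec.2 else 0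

/-- Iterated transition maps of the directed system `ℓ ↦ Ext_A^t(A/m_ℓ, A_P)_α`. -/
def transChain (t : ℕ) (α : Fin n → ℤ) {i j : ℕ} (h : i ≤ j) :
    ExtPiece P k n x i t α →ₗ[k] ExtPiece P k n x j t α :=
  Nat.leRecOn h (fun {m} g => (transExt P k n x m t α).comp g) LinearMap.id

/-- The graded piece `H_m^t(A_P)_α` of local cohomology: the direct limit over `ℓ` of
`Ext_A^t(A/m_ℓ, A_P)_α` along the transition maps induced by the projections
`A/m_{ℓ+1} → A/m_ℓ`. -/
abbrev LocCoh (t : ℕ) (α : Fin n → ℤ) :=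
  Module.DirectLimit (R := k) (ι := ℕ) (fun ℓ => ExtPiece P k n x ℓ t α)
    (fun _ _ h => transChain P k n x t α h)


section Cohomology
variable (Q : Type) [Fintype Q] [PartialOrder Q]

/-- The simplicial coboundary operator of a complex `K` of finite chains in a poset `Q`
(each face being a chain is canonically oriented by the order of `Q`):
`(δf)(s) = Σ_{v ∈ s} (-1)^{|{u ∈ s : u < v}|} f(s \ {v})` for `s ∈ K`, and `0` otherwise. -/
def cDelta (K : Set (Finset Q)) : (Finset Q → k) →ₗ[k] (Finset Q → k) :=
  LinearMap.pi fun s =>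
    if s ∈ K then
      ∑ v ∈ s, ((-1 : k) ^ ((s.filter fun u => u < v).card)) • LinearMap.proj (s.erase v)
    else 0

/-- Cochains of (cohomological) degree `i`: functions supported on faces of `K` with
`i + 1` vertices. -/
def cGraded (K : Set (Finset Q)) (i : ℤ) : Submodule k (Finset Q → k) :=
  Submodule.pi Set.univ fun s => if s ∈ K ∧ (s.card : ℤ) = i + 1 then ⊤ else ⊥

/-- Degree-`i` cocycles. -/
def ZC (K : Set (Finset Q)) (i : ℤ) : Submodule k (Finset Q → k) :=
  LinearMap.ker (cDelta k Q K) ⊓ cGraded k Q K i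

/-- Degree-`i` coboundaries. -/
def BC (K : Set (Finset Q)) (i : ℤ) : Submodule k (Finset Q → k) :=
  Submodule.map (cDelta k Q K) (cGraded k Q K (i - 1))

/-- The degree-`i` cohomology (with coefficients in `k`) of a complex `K` of chains
in `Q`. -/
abbrev Coh (K : Set (Finset Q)) (i : ℤ) :=
  ↥(ZC k Q K i) ⧸ Submodule.comap (ZC k Q K i).subtype (BC k Q K i)

/-- The full complex of chains of `Q` minus its minimal elements: the order complex
`Δ(Q̄)` (including the empty face, so `Coh` of it is *reduced* cohomology). -/
def chainsK : Set (Finset Q) :=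
  {s | (∀ q ∈ s, ¬ IsMin q) ∧ IsChain (· ≤ ·) (↑s : Set Q)}

/-- Reduced cohomology `H̃^i(Q)` of (the order complex of) a poset `Q`. -/
abbrev ReducedCoh (i : ℤ) := Coh k Q (chainsK Q) i

/-- The relative complex of the pair `(Q, R)` for a subset `R ⊆ Q`: faces of the order
complex of `Q` not lying in `R`; `Coh` of it is the relative cohomology `H^i(Q, R)`. -/
def relK (R : Set Q) : Set (Finset Q) :=
  {s | s ∈ chainsK Q ∧ ¬ (↑s : Set Q) ⊆ R}

/-- Relative cohomology `H^i(Q, R)`. -/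
abbrev RelCoh (R : Set Q) (i : ℤ) := Coh k Q (relK Q R) i

/-- The link of a face `F` of the order complex of `Q`. -/
def linkK (F : Finset Q) : Set (Finset Q) :=
  {s | (∀ q ∈ s, q ∉ F) ∧ (∀ q ∈ s ∪ F, ¬ IsMin q) ∧
    IsChain (· ≤ ·) (↑(s ∪ F) : Set Q)}
end Cohomology

/-- The contrastar `cost_P(y) = {z : ¬ y ≤ z}`. -/
def cost {P : Type} [PartialOrder P] (y : P) : Set P := {z | ¬ y ≤ z}

set_option linter.unusedSectionVars false
namespace HL

section Poset
variable {P : Type} [Fintype P] [PartialOrder P] [OrderBot P] {n : ℕ}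

/-- The standing hypotheses: a simplicial poset together with a labelling of its atoms. -/
structure SPos (x : Fin n → P) : Prop where
  hP : IsSimplicialPoset P
  hinj : Function.Injective x
  hatom : ∀ i, IsAtom (x i)
  hsurj : ∀ a : P, IsAtom a → ∃ i, x i = a

/-- The support of a face. -/
def sp (x : Fin n → P) (y : P) : Finset (Fin n) := Finset.univ.filter fun i => x i ≤ y

variable {x : Fin n → P}

lemma mem_sp {y : P} {i : Fin n} : i ∈ sp x y ↔ x i ≤ y := by simp [sp]

lemma sp_mono {u y : P} (h : u ≤ y) : sp x u ⊆ sp x y := by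
  intro i hi
  rw [mem_sp] at *
  exact hi.trans h

lemma isoBot {y : P} {m : ℕ} (e : Set.Icc (⊥ : P) y ≃o Finset (Fin m)) (q : Set.Icc (⊥ : P) y) :
    e q = ∅ ↔ q.1 = ⊥ := by
  have h0 : e ⟨⊥, le_refl _, bot_le⟩ = ∅ := by
    apply Finset.subset_empty.1
    have : (⟨⊥, le_refl _, bot_le⟩ : Set.Icc (⊥ : P) y) ≤ e.symm ∅ := (bot_le : (⊥ : P) ≤ _)
    have := e.monotone this
    simpa using this
  constructor
  · intro h
    have : q = ⟨⊥, le_refl _, bot_le⟩ := e.injective (h.trans h0.symm)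
    rw [this]
  · intro h
    have : q = ⟨⊥, le_refl _, bot_le⟩ := Subtype.ext h
    rw [this, h0]

lemma iso_atom {y : P} {m : ℕ} (e : Set.Icc (⊥ : P) y ≃o Finset (Fin m)) (a : Fin m) :
    IsAtom (e.symm {a}).1 := by
  constructor
  · intro h
    have := (isoBot e _).2 h
    simp at this
  · intro b hb
    have hby : b ≤ y := hb.le.trans (e.symm {a}).2.2
    have h1 : (⟨b, bot_le, hby⟩ : Set.Icc (⊥ : P) y) < e.symm {a} := hb
    have h2 := e.strictMono h1
    rw [e.apply_symm_apply] at h2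
    have h3 : e ⟨b, bot_le, hby⟩ = ∅ := by simpa using h2
    exact (isoBot e _).1 h3

lemma SPos.iso_x (h : SPos x) {y : P} {m : ℕ} (e : Set.Icc (⊥ : P) y ≃o Finset (Fin m))
    {i : Fin n} (hi : x i ≤ y) : ∃ a, e ⟨x i, bot_le, hi⟩ = {a} := by
  have hne : e ⟨x i, bot_le, hi⟩ ≠ ∅ := fun h0 => (h.hatom i).1 ((isoBot e _).1 h0)
  obtain ⟨a, ha⟩ := Finset.nonempty_iff_ne_empty.2 hne
  refine ⟨a, ?_⟩
  have h1 : ({a} : Finset (Fin m)) ≤ e ⟨x i, bot_le, hi⟩ := by simpa using ha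
  have h2 : e.symm {a} ≤ ⟨x i, bot_le, hi⟩ := by
    rw [e.symm_apply_le]; exact h1
  have h3 : (e.symm {a}).1 = x i := by
    rcases (h.hatom i).le_iff.1 (show (e.symm {a}).1 ≤ x i from h2) with h4 | h4
    · exact absurd h4 (iso_atom e a).1
    · exact h4
  have h4 : (⟨x i, bot_le, hi⟩ : Set.Icc (⊥ : P) y) = e.symm {a} := Subtype.ext h3.symm
  rw [h4, e.apply_symm_apply]

lemma SPos.le_iff (h : SPos x) {u z y : P} (hu : u ≤ y) (hz : z ≤ y) :
    u ≤ z ↔ sp x u ⊆ sp x z := by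
  refine ⟨sp_mono, fun hs => ?_⟩
  obtain ⟨m, ⟨e⟩⟩ := h.hP y
  have key : e ⟨u, bot_le, hu⟩ ≤ e ⟨z, bot_le, hz⟩ := by
    intro a ha
    have h1 : e.symm {a} ≤ ⟨u, bot_le, hu⟩ := by
      rw [e.symm_apply_le]; simpa using ha
    obtain ⟨i, hi⟩ := h.hsurj _ (iso_atom e a)
    have h2 : x i ≤ z := mem_sp.1 (hs (mem_sp.2 (hi ▸ h1)))
    have h3 : e.symm {a} ≤ ⟨z, bot_le, hz⟩ := by
      rw [hi] at h2; exact h2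
    rw [e.symm_apply_le] at h3
    simpa using h3
  have := e.le_iff_le.1 key
  exact this

lemma SPos.eq_of (h : SPos x) {u z y : P} (hu : u ≤ y) (hz : z ≤ y) (hs : sp x u = sp x z) :
    u = z :=
  le_antisymm ((h.le_iff hu hz).2 hs.le) ((h.le_iff hz hu).2 hs.ge)

lemma SPos.exists_rs (h : SPos x) {y : P} {S : Finset (Fin n)} (hS : S ⊆ sp x y) :
    ∃ z, z ≤ y ∧ sp x z = S := by
  obtain ⟨m, ⟨e⟩⟩ := h.hP y
  let A : Finset (Fin m) := Finset.univ.filter fun a => ∃ i ∈ S, x i = (e.symm {a}).1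
  refine ⟨(e.symm A).1, (e.symm A).2.2, ?_⟩
  ext i
  rw [mem_sp]
  constructor
  · intro hi
    have hy : x i ≤ y := hi.trans (e.symm A).2.2
    obtain ⟨a, ha⟩ := h.iso_x e hy
    have h1 : (⟨x i, bot_le, hy⟩ : Set.Icc (⊥ : P) y) ≤ e.symm A := hi
    rw [e.le_symm_apply, ha] at h1
    have h2 : a ∈ A := by simpa using h1
    obtain ⟨i', hi', hx⟩ := (Finset.mem_filter.1 h2).2
    have : x i' = x i := by
      rw [hx, ← ha]; simp
    rwa [← h.hinj this]
  · intro hi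
    have hy : x i ≤ y := mem_sp.1 (hS hi)
    obtain ⟨a, ha⟩ := h.iso_x e hy
    have h1 : (⟨x i, bot_le, hy⟩ : Set.Icc (⊥ : P) y) ≤ e.symm A := by
      rw [e.le_symm_apply, ha]
      simp only [Finset.singleton_subset_iff, A, Finset.mem_filter,
        Finset.mem_univ, true_and]
      exact ⟨i, hi, by rw [← ha]; simp⟩
    exact h1

/-- The face of `y` with support `S`. -/
def rs (x : Fin n → P) (y : P) (S : Finset (Fin n)) : P :=
  Classical.epsilon fun z => z ≤ y ∧ sp x z = S

lemma SPos.rs_le (h : SPos x) {y : P} {S : Finset (Fin n)} (hS : S ⊆ sp x y) : rs x y S ≤ y :=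
  (Classical.epsilon_spec (h.exists_rs hS)).1

lemma SPos.sp_rs (h : SPos x) {y : P} {S : Finset (Fin n)} (hS : S ⊆ sp x y) :
    sp x (rs x y S) = S :=
  (Classical.epsilon_spec (h.exists_rs hS)).2

lemma SPos.eq_rs (h : SPos x) {y z : P} (hz : z ≤ y) : rs x y (sp x z) = z :=
  h.eq_of (h.rs_le (sp_mono hz)) hz (h.sp_rs (sp_mono hz))

lemma SPos.sp_bot (h : SPos x) : sp x (⊥ : P) = ∅ := by
  ext i
  simp only [mem_sp, le_bot_iff, Finset.notMem_empty, iff_false]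
  exact (h.hatom i).1

lemma SPos.sp_x (h : SPos x) (i : Fin n) : sp x (x i) = {i} := by
  ext j
  rw [mem_sp, Finset.mem_singleton]
  constructor
  · intro hj
    rcases (h.hatom i).le_iff.1 hj with h1 | h1
    · exact absurd h1 (h.hatom j).1
    · exact h.hinj h1
  · rintro rfl; exact le_rfl

lemma SPos.glb (h : SPos x) {w y v : P} (hw : w ≤ v) (hy : y ≤ v) :
    IsGLB {w, y} (rs x v (sp x w ∩ sp x y)) := by
  have hS : sp x w ∩ sp x y ⊆ sp x v := Finset.inter_subset_left.trans (sp_mono hw)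
  constructor
  · intro a ha
    rcases ha with rfl | ha
    · rw [h.le_iff (h.rs_le hS) hw, h.sp_rs hS]; exact Finset.inter_subset_left
    · rw [Set.mem_singleton_iff] at ha
      subst ha
      rw [h.le_iff (h.rs_le hS) hy, h.sp_rs hS]; exact Finset.inter_subset_right
  · intro b hb
    have h1 : b ≤ w := hb (by simp)
    have h2 : b ≤ y := hb (by simp)
    rw [h.le_iff (h1.trans hw) (h.rs_le hS), h.sp_rs hS]
    exact Finset.subset_inter (sp_mono h1) (sp_mono h2)

lemma mem_ub {w y z : P} : z ∈ upperBounds {w, y} ↔ w ≤ z ∧ y ≤ z := by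
  simp [upperBounds]

lemma SPos.mub_iff (h : SPos x) {w y v u : P} (hw : w ≤ v) (hy : y ≤ v) (hu : u ≤ v) :
    u ∈ MUB w y ↔ sp x u = sp x w ∪ sp x y := by
  have hS : sp x w ∪ sp x y ⊆ sp x v := Finset.union_subset (sp_mono hw) (sp_mono hy)
  have hj1 : w ≤ rs x v (sp x w ∪ sp x y) := by
    rw [h.le_iff hw (h.rs_le hS), h.sp_rs hS]; exact Finset.subset_union_left
  have hj2 : y ≤ rs x v (sp x w ∪ sp x y) := by
    rw [h.le_iff hy (h.rs_le hS), h.sp_rs hS]; exact Finset.subset_union_right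
  constructor
  · intro hm
    have h1 := mem_ub.1 hm.1
    have h2 := hm.2 _ (mem_ub.2 ⟨hj1, hj2⟩) (by
      rw [h.le_iff (h.rs_le hS) hu, h.sp_rs hS]
      exact Finset.union_subset (sp_mono h1.1) (sp_mono h1.2))
    rw [← h2, h.sp_rs hS]
  · intro hs
    refine ⟨mem_ub.2 ⟨?_, ?_⟩, ?_⟩
    · rw [h.le_iff hw hu, hs]; exact Finset.subset_union_left
    · rw [h.le_iff hy hu, hs]; exact Finset.subset_union_right
    · intro z' hz' hle
      have h1 := mem_ub.1 hz'
      apply le_antisymm hle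
      rw [h.le_iff hu (hle.trans hu), hs]
      exact Finset.union_subset (sp_mono h1.1) (sp_mono h1.2)

lemma SPos.sp_mub (h : SPos x) {w y u : P} (hu : u ∈ MUB w y) : sp x u = sp x w ∪ sp x y := by
  have h1 := mem_ub.1 hu.1
  exact (h.mub_iff h1.1 h1.2 le_rfl).1 hu

/-- Erasing an atom from a face. -/
def er (x : Fin n → P) (z : P) (j : Fin n) : P := rs x z ((sp x z).erase j)

lemma SPos.er_le (h : SPos x) (z : P) (j : Fin n) : er x z j ≤ z :=
  h.rs_le (Finset.erase_subset _ _)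

lemma SPos.sp_er (h : SPos x) (z : P) (j : Fin n) : sp x (er x z j) = (sp x z).erase j :=
  h.sp_rs (Finset.erase_subset _ _)

lemma SPos.er_er (h : SPos x) (z : P) (i j : Fin n) : er x (er x z j) i = er x (er x z i) j := by
  apply h.eq_of ((h.er_le _ _).trans (h.er_le z _)) ((h.er_le _ _).trans (h.er_le z _))
  simp only [h.sp_er]
  exact Finset.erase_right_comm

end Poset

section Ring
variable {P : Type} [Fintype P] [PartialOrder P] [OrderBot P] {n : ℕ} {k : Type} [Field k]
variable {x : Fin n → P}

lemma fv_bot : fv P k (⊥ : P) = 1 := by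
  have h : (X (⊥ : P) - 1 : MvPolynomial P k) ∈ faceIdeal P k :=
    Ideal.subset_span (Or.inr rfl)
  have := (Ideal.Quotient.eq (I := faceIdeal P k)).2 h
  simpa [fv] using this

lemma fv_mul_zero {w y : P} (h : upperBounds {w, y} = ∅) : fv P k w * fv P k y = 0 := by
  have h : (X w * X y : MvPolynomial P k) ∈ faceIdeal P k :=
    Ideal.subset_span (Or.inl (Or.inl ⟨w, y, h, rfl⟩))
  have := Ideal.Quotient.eq_zero_iff_mem.2 h
  simpa [fv] using this

lemma fv_mul {w y m : P} (h : (upperBounds {w, y}).Nonempty) (hm : IsGLB {w, y} m) :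
    fv P k w * fv P k y = fv P k m * ∑ z ∈ (Set.toFinite (MUB w y)).toFinset, fv P k z := by
  have h : (X w * X y - X m * ∑ z ∈ (Set.toFinite (MUB w y)).toFinset, X z : MvPolynomial P k)
      ∈ faceIdeal P k :=
    Ideal.subset_span (Or.inl (Or.inr ⟨w, y, m, h, hm, rfl⟩))
  have := Ideal.Quotient.eq_zero_iff_mem.2 h
  rw [map_sub, sub_eq_zero] at this
  simpa [fv] using this

lemma SPos.mub_sum (h : SPos x) {w y z : P} (hw : w ≤ z) (hy : y ≤ z) {M : Type*}
    [AddCommMonoid M] (F : P → M) (hF : ∀ u ∈ MUB w y, ¬ u ≤ z → F u = 0) :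
    ∑ u ∈ (Set.toFinite (MUB w y)).toFinset, F u = F (rs x z (sp x w ∪ sp x y)) := by
  have hS : sp x w ∪ sp x y ⊆ sp x z := Finset.union_subset (sp_mono hw) (sp_mono hy)
  have hm : rs x z (sp x w ∪ sp x y) ∈ MUB w y :=
    (h.mub_iff hw hy (h.rs_le hS)).2 (h.sp_rs hS)
  apply Finset.sum_eq_single_of_mem
  · simpa using hm
  · intro u hu hne
    have hu : u ∈ MUB w y := by simpa using hu
    apply hF u hu
    intro hle
    apply hne
    exact h.eq_of hle (h.rs_le hS) ((h.sp_mub hu).trans (h.sp_rs hS).symm)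

lemma SPos.fv_mub_zero (h : SPos x) {w y z u : P} (hw : w ≤ z) (hy : y ≤ z) (hu : u ∈ MUB w y)
    (hz : ¬ u ≤ z) : fv P k z * fv P k u = 0 := by
  apply fv_mul_zero
  rw [Set.eq_empty_iff_forall_notMem]
  intro v hv
  have hv := mem_ub.1 hv
  apply hz
  rw [h.le_iff hv.2 hv.1, h.sp_mub hu]
  exact Finset.union_subset (sp_mono hw) (sp_mono hy)

lemma SPos.fv_mul_mul (h : SPos x) {w y z : P} (hw : w ≤ z) (hy : y ≤ z) :
    fv P k z * (fv P k w * fv P k y) =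
      fv P k z * (fv P k (rs x z (sp x w ∩ sp x y)) * fv P k (rs x z (sp x w ∪ sp x y))) := by
  rw [fv_mul ⟨z, mem_ub.2 ⟨hw, hy⟩⟩ (h.glb hw hy), mul_left_comm, Finset.mul_sum,
    h.mub_sum hw hy (fun u => fv P k z * fv P k u)
      (fun u hu hz => h.fv_mub_zero hw hy hu hz), mul_left_comm]

lemma SPos.fv_mul_le (h : SPos x) {y z : P} (hy : y ≤ z) :
    fv P k z * fv P k y = fv P k z * ∏ j ∈ sp x y, fv P k (x j) := by
  suffices H : ∀ S : Finset (Fin n), S ⊆ sp x z →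
      fv P k z * fv P k (rs x z S) = fv P k z * ∏ j ∈ S, fv P k (x j) by
    have := H (sp x y) (sp_mono hy)
    rwa [h.eq_rs hy] at this
  intro S
  induction S using Finset.induction_on with
  | empty =>
    intro _
    have : rs x z ∅ = ⊥ := by
      rw [← h.sp_bot]; exact h.eq_rs bot_le
    rw [this, fv_bot]; simp
  | insert j S hj ih =>
    intro hS
    have hS' : S ⊆ sp x z := (Finset.subset_insert _ _).trans hS
    have hjz : x j ≤ z := mem_sp.1 (hS (Finset.mem_insert_self _ _))
    have h1 := h.fv_mul_mul (k := k) hjz (h.rs_le hS')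
    rw [h.sp_x, h.sp_rs hS'] at h1
    have h2 : ({j} : Finset (Fin n)) ∩ S = ∅ := by
      rw [Finset.singleton_inter_of_notMem hj]
    have h3 : rs x z ∅ = ⊥ := by
      rw [← h.sp_bot]; exact h.eq_rs bot_le
    rw [h2, h3, fv_bot, one_mul, ← Finset.insert_eq] at h1
    rw [← h1, Finset.prod_insert hj, mul_left_comm, ih hS', mul_left_comm]

/-- Evaluation at the face `z`: the algebra map sending `y` to `1` if `y ≤ z` and to `0`
otherwise. -/
def SPos.ev (h : SPos x) (k : Type) [Field k] (z : P) : FaceRing P k →ₐ[k] k :=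
  Ideal.Quotient.liftₐ (faceIdeal P k) (aeval fun y : P => if y ≤ z then (1 : k) else 0) <| by
    intro a ha
    have : faceIdeal P k ≤
        RingHom.ker (aeval fun y : P => if y ≤ z then (1 : k) else 0 : MvPolynomial P k →ₐ[k] k) := by
      unfold faceIdeal
      rw [Ideal.span_le]
      rintro f ((⟨w, y, hub, rfl⟩ | ⟨w, y, m, hub, hm, rfl⟩) | rfl)
      · simp only [SetLike.mem_coe, RingHom.mem_ker, map_mul, aeval_X]
        by_cases hw : w ≤ z
        · by_cases hy : y ≤ z
          · exact absurd (mem_ub.2 ⟨hw, hy⟩) (by rw [hub]; simp)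
          · simp [hy]
        · simp [hw]
      · simp only [SetLike.mem_coe, RingHom.mem_ker, map_sub, map_mul, aeval_X, map_sum]
        by_cases hwy : w ≤ z ∧ y ≤ z
        · obtain ⟨hw, hy⟩ := hwy
          have hS : sp x w ∪ sp x y ⊆ sp x z := Finset.union_subset (sp_mono hw) (sp_mono hy)
          rw [h.mub_sum hw hy]
          · have hmw : m ≤ w := hm.1 (by simp)
            simp [hw, hy, h.rs_le hS, hmw.trans hw]
          · intro u _ hu
            simp [hu]
        · rw [Finset.sum_eq_zero]
          · by_cases hw : w ≤ z
            · have hy : ¬ y ≤ z := fun hy => hwy ⟨hw, hy⟩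
              simp [hy]
            · simp [hw]
          · intro u hu
            have hu : u ∈ MUB w y := by simpa using hu
            have hu := mem_ub.1 hu.1
            rw [if_neg]
            exact fun hz => hwy ⟨hu.1.trans hz, hu.2.trans hz⟩
      · simp [RingHom.mem_ker]
    exact this ha

lemma SPos.ev_fv (h : SPos x) (z y : P) : h.ev k z (fv P k y) = if y ≤ z then 1 else 0 := by
  have : h.ev k z (fv P k y) =
    (aeval fun y : P => if y ≤ z then (1 : k) else 0) (X y : MvPolynomial P k) := rfl
  rw [this, aeval_X]

/-- Standard basis elements of the graded pieces. -/
def E (k : Type) [Field k] (x : Fin n → P) (z : P) (b : Fin n → ℕ) : FaceRing P k :=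
  fv P k z * ∏ j, fv P k (x j) ^ (b j - 1)

/-- The support of an exponent vector. -/
def spb (b : Fin n → ℕ) : Finset (Fin n) := Finset.univ.filter fun j => b j ≠ 0

lemma mem_spb {b : Fin n → ℕ} {j : Fin n} : j ∈ spb b ↔ b j ≠ 0 := by simp [spb]

/-- The span of the standard basis elements of degree `b`. -/
def EE (k : Type) [Field k] (x : Fin n → P) (b : Fin n → ℕ) : Submodule k (FaceRing P k) :=
  Submodule.span k {r | ∃ z, sp x z = spb b ∧ r = E k x z b}

lemma prod_sp (S : Finset (Fin n)) : ∏ j ∈ S, fv P k (x j) =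
    ∏ j, fv P k (x j) ^ (if j ∈ S then 1 else 0) := by
  rw [← Finset.prod_subset (Finset.subset_univ S)]
  · apply Finset.prod_congr rfl
    intro j hj; simp [hj]
  · intro j _ hj; simp [hj]

lemma SPos.E_mul (h : SPos x) {z z' : P} {b b' : Fin n → ℕ} (hz : sp x z = spb b)
    (hz' : sp x z' = spb b') : E k x z b * E k x z' b' ∈ EE k x (b + b') := by
  by_cases hub : (upperBounds {z, z'}).Nonempty
  · obtain ⟨v, hv⟩ := hub
    obtain ⟨hv1, hv2⟩ := mem_ub.1 hv
    have h1 : E k x z b * E k x z' b' =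
        ∑ u ∈ (Set.toFinite (MUB z z')).toFinset, E k x u (b + b') := by
      have : E k x z b * E k x z' b' = (fv P k z * fv P k z') *
        ((∏ j, fv P k (x j) ^ (b j - 1)) * ∏ j, fv P k (x j) ^ (b' j - 1)) := by
        unfold E; ring
      rw [this, fv_mul ⟨v, hv⟩ (h.glb hv1 hv2), mul_comm (fv P k _), Finset.sum_mul,
        Finset.sum_mul]
      apply Finset.sum_congr rfl
      intro u hu
      have hu : u ∈ MUB z z' := by simpa using hu
      have hu' := mem_ub.1 hu.1
      have hS : sp x z ∩ sp x z' ⊆ sp x v := Finset.inter_subset_left.trans (sp_mono hv1)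
      have hle : rs x v (sp x z ∩ sp x z') ≤ u :=
        ((h.glb hv1 hv2).1 (by simp : z ∈ _)).trans hu'.1
      rw [h.fv_mul_le hle, h.sp_rs hS, mul_assoc, prod_sp, ← Finset.prod_mul_distrib,
        ← Finset.prod_mul_distrib]
      unfold E
      congr 1
      apply Finset.prod_congr rfl
      intro j _
      rw [← pow_add, ← pow_add, hz, hz']
      congr 1
      simp only [Finset.mem_inter, mem_spb, Pi.add_apply]
      split_ifs <;> omega
    rw [h1]
    apply Submodule.sum_mem
    intro u hu
    have hu : u ∈ MUB z z' := by simpa using hu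
    apply Submodule.subset_span
    refine ⟨u, ?_, rfl⟩
    rw [h.sp_mub hu, hz, hz']
    ext j
    simp only [Finset.mem_union, mem_spb, Pi.add_apply]
    omega
  · have : E k x z b * E k x z' b' = (fv P k z * fv P k z') *
        ((∏ j, fv P k (x j) ^ (b j - 1)) * ∏ j, fv P k (x j) ^ (b' j - 1)) := by
        unfold E; ring
    rw [this, fv_mul_zero (Set.not_nonempty_iff_eq_empty.1 hub), zero_mul]
    exact Submodule.zero_mem _

lemma SPos.EE_mul (h : SPos x) {b b' : Fin n → ℕ} {r r' : FaceRing P k}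
    (hr : r ∈ EE k x b) (hr' : r' ∈ EE k x b') : r * r' ∈ EE k x (b + b') := by
  induction hr using Submodule.span_induction with
  | mem r hr =>
    obtain ⟨z, hz, rfl⟩ := hr
    induction hr' using Submodule.span_induction with
    | mem r hr =>
      obtain ⟨z', hz', rfl⟩ := hr
      exact h.E_mul hz hz'
    | zero => rw [mul_zero]; exact Submodule.zero_mem _
    | add a b _ _ ha hb => rw [mul_add]; exact Submodule.add_mem _ ha hb
    | smul c a _ ha => rw [mul_smul_comm]; exact Submodule.smul_mem _ _ ha
  | zero => rw [zero_mul]; exact Submodule.zero_mem _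
  | add a b _ _ ha hb => rw [add_mul]; exact Submodule.add_mem _ ha hb
  | smul c a _ ha => rw [smul_mul_assoc]; exact Submodule.smul_mem _ _ ha

lemma SPos.one_EE (h : SPos x) : (1 : FaceRing P k) ∈ EE k x 0 := by
  apply Submodule.subset_span
  refine ⟨⊥, ?_, ?_⟩
  · rw [h.sp_bot]; ext j; simp [mem_spb]
  · simp [E, fv_bot]

/-- The degree of a face. -/
def dg (x : Fin n → P) (y : P) : Fin n → ℕ := fun j => if x j ≤ y then 1 else 0

lemma SPos.fv_EE (_h : SPos x) (y : P) : fv P k y ∈ EE k x (dg x y) := by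
  apply Submodule.subset_span
  refine ⟨y, ?_, ?_⟩
  · ext j; simp [mem_spb, mem_sp, dg]
  · rw [E, Finset.prod_eq_one, mul_one]
    intro j _
    have : dg x y j - 1 = 0 := by unfold dg; split_ifs <;> rfl
    rw [this, pow_zero]

lemma SPos.pow_EE (h : SPos x) (y : P) (m : ℕ) : fv P k y ^ m ∈ EE k x (m • dg x y) := by
  induction m with
  | zero => simpa using h.one_EE
  | succ m ih =>
    rw [pow_succ, add_smul, one_smul]
    exact h.EE_mul ih (h.fv_EE y)

lemma SPos.mono_EE (h : SPos x) (σ : P →₀ ℕ) :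
    Ideal.Quotient.mk (faceIdeal P k) (monomial σ (1 : k)) ∈
      EE k x (∑ y ∈ σ.support, σ y • dg x y) := by
  rw [monomial_eq, C_1, one_mul, Finsupp.prod, map_prod]
  induction σ.support using Finset.induction_on with
  | empty => simpa using h.one_EE
  | insert y S hy ih =>
    rw [Finset.prod_insert hy, Finset.sum_insert hy]
    refine h.EE_mul ?_ ih
    rw [map_pow]
    exact h.pow_EE y _

lemma SPos.facePiece_le (h : SPos x) (b : Fin n → ℕ) :
    facePiece P k n x (fun j => (b j : ℤ)) ≤ EE k x b := by
  unfold facePiece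
  rw [Submodule.span_le]
  rintro r ⟨σ, hσ, rfl⟩
  have : (∑ y ∈ σ.support, σ y • dg x y) = b := by
    funext j
    have := hσ j
    simp only at this
    zify
    rw [← this, Finset.sum_apply]
    push_cast
    apply Finset.sum_congr rfl
    intro y _
    simp [dg]
  rw [← this]
  exact h.mono_EE σ

lemma facePiece_neg {β : Fin n → ℤ} {j : Fin n} (hj : β j < 0) :
    facePiece P k n x β = ⊥ := by
  unfold facePiece
  rw [Submodule.span_eq_bot]
  rintro r ⟨σ, hσ, -⟩
  exfalso
  have := hσ j
  have h2 : 0 ≤ (∑ y ∈ σ.support, if x j ≤ y then (σ y : ℤ) else 0) := by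
    apply Finset.sum_nonneg
    intro y _
    split_ifs <;> positivity
  omega

lemma deg_sum (σ : P →₀ ℕ) (j : Fin n) :
    (∑ y ∈ σ.support, if x j ≤ y then (σ y : ℤ) else 0) =
      σ.sum fun y m => if x j ≤ y then (m : ℤ) else 0 := rfl

lemma facePiece_mul {β γ : Fin n → ℤ} {r s : FaceRing P k} (hr : r ∈ facePiece P k n x β)
    (hs : s ∈ facePiece P k n x γ) : r * s ∈ facePiece P k n x (β + γ) := by
  unfold facePiece at *
  induction hr using Submodule.span_induction with
  | mem r hr =>
    obtain ⟨σ, hσ, rfl⟩ := hr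
    induction hs using Submodule.span_induction with
    | mem r hr =>
      obtain ⟨τ, hτ, rfl⟩ := hr
      apply Submodule.subset_span
      refine ⟨σ + τ, ?_, ?_⟩
      · intro j
        rw [deg_sum, Finsupp.sum_add_index']
        · rw [← deg_sum, ← deg_sum, hσ, hτ]; rfl
        · intro y; simp
        · intro y a b; split_ifs <;> simp
      · rw [← map_mul, monomial_mul, one_mul]
    | zero => rw [mul_zero]; exact Submodule.zero_mem _
    | add a b _ _ ha hb => rw [mul_add]; exact Submodule.add_mem _ ha hb
    | smul c a _ ha => rw [mul_smul_comm]; exact Submodule.smul_mem _ _ ha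
  | zero => rw [zero_mul]; exact Submodule.zero_mem _
  | add a b _ _ ha hb => rw [add_mul]; exact Submodule.add_mem _ ha hb
  | smul c a _ ha => rw [smul_mul_assoc]; exact Submodule.smul_mem _ _ ha

lemma one_facePiece : (1 : FaceRing P k) ∈ facePiece P k n x 0 := by
  apply Submodule.subset_span
  exact ⟨0, by simp, by simp [← C_apply]⟩

lemma fv_facePiece (y : P) : fv P k y ∈ facePiece P k n x (fun j => if x j ≤ y then 1 else 0) := by
  apply Submodule.subset_span
  refine ⟨Finsupp.single y 1, ?_, rfl⟩
  intro j
  rw [deg_sum, Finsupp.sum_single_index] <;> simp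

lemma pow_facePiece {β : Fin n → ℤ} {r : FaceRing P k} (hr : r ∈ facePiece P k n x β) (m : ℕ) :
    r ^ m ∈ facePiece P k n x (m • β) := by
  induction m with
  | zero => simpa using one_facePiece
  | succ m ih =>
    rw [pow_succ, add_smul, one_smul]
    exact facePiece_mul ih hr

lemma prod_facePiece {ι : Type*} (s : Finset ι) (r : ι → FaceRing P k) (β : ι → Fin n → ℤ)
    (hr : ∀ i ∈ s, r i ∈ facePiece P k n x (β i)) :
    ∏ i ∈ s, r i ∈ facePiece P k n x (∑ i ∈ s, β i) := by
  induction s using Finset.induction_on with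
  | empty => simpa using one_facePiece
  | insert y S hy ih =>
    rw [Finset.prod_insert hy, Finset.sum_insert hy]
    exact facePiece_mul (hr _ (Finset.mem_insert_self _ _))
      (ih fun i hi => hr i (Finset.mem_insert_of_mem hi))

lemma SPos.x_facePiece (h : SPos x) (j : Fin n) :
    fv P k (x j) ∈ facePiece P k n x (Pi.single j 1) := by
  convert fv_facePiece (x := x) (k := k) (x j) using 2
  funext i
  rw [← mem_sp, h.sp_x, Finset.mem_singleton, Pi.single_apply]
  split_ifs <;> rfl

lemma SPos.E_facePiece (h : SPos x) {z : P} {b : Fin n → ℕ} (hz : sp x z = spb b) :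
    E k x z b ∈ facePiece P k n x (fun j => (b j : ℤ)) := by
  have := facePiece_mul (fv_facePiece (x := x) (k := k) z)
    (prod_facePiece Finset.univ (fun j => fv P k (x j) ^ (b j - 1)) _
      (fun j _ => pow_facePiece (h.x_facePiece (k := k) j) (b j - 1)))
  unfold E
  convert this using 2
  funext i
  simp only [Pi.add_apply, Finset.sum_apply, nsmul_eq_mul, Pi.mul_apply,
    Pi.natCast_apply]
  rw [Finset.sum_eq_single_of_mem i (Finset.mem_univ i)
    (fun j _ hj => by rw [Pi.single_eq_of_ne hj.symm, mul_zero]), Pi.single_eq_same, mul_one]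
  have : x i ≤ z ↔ b i ≠ 0 := by rw [← mem_sp, hz, mem_spb]
  by_cases hi : x i ≤ z
  · have h1 := this.1 hi
    rw [if_pos hi]; omega
  · have h1 : b i = 0 := by
      by_contra h2
      exact hi (this.2 h2)
    rw [if_neg hi]; omega

lemma SPos.ev_x (h : SPos x) (z : P) (j : Fin n) :
    h.ev k z (fv P k (x j)) = if j ∈ sp x z then 1 else 0 := by
  rw [h.ev_fv]; simp [mem_sp]

lemma SPos.ev_E (h : SPos x) {z u : P} {b : Fin n → ℕ} (hu : sp x u = spb b) :
    h.ev k z (E k x u b) = if u ≤ z then 1 else 0 := by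
  rw [E, map_mul, h.ev_fv, map_prod]
  split_ifs with hle
  · rw [one_mul, Finset.prod_eq_one]
    intro j _
    rw [map_pow, h.ev_x]
    by_cases hj : j ∈ sp x u
    · rw [if_pos (sp_mono hle hj), one_pow]
    · have : b j - 1 = 0 := by rw [hu, mem_spb] at hj; omega
      rw [this, pow_zero]
  · rw [zero_mul]

lemma SPos.ev_mono (h : SPos x) {z z' : P} {b : Fin n → ℕ} (hz : z ≤ z') (hb : spb b ⊆ sp x z)
    {r : FaceRing P k} (hr : r ∈ facePiece P k n x (fun j => (b j : ℤ))) :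
    h.ev k z r = h.ev k z' r := by
  replace hr := h.facePiece_le b hr
  induction hr using Submodule.span_induction with
  | mem r hr =>
    obtain ⟨u, hu, rfl⟩ := hr
    rw [h.ev_E hu, h.ev_E hu]
    have : u ≤ z ↔ u ≤ z' := by
      constructor
      · exact fun h1 => h1.trans hz
      · intro h1
        rw [h.le_iff h1 hz, hu]; exact hb
    simp [this]
  | zero => simp
  | add a b _ _ ha hb => rw [map_add, map_add, ha, hb]
  | smul c a _ ha => rw [map_smul, map_smul, ha]

lemma SPos.repr (h : SPos x) {b : Fin n → ℕ}
    {r : FaceRing P k} (hr : r ∈ facePiece P k n x (fun j => (b j : ℤ))) :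
    r = ∑ z ∈ Finset.univ.filter (fun z => sp x z = spb b), h.ev k z r • E k x z b := by
  replace hr := h.facePiece_le b hr
  induction hr using Submodule.span_induction with
  | mem r hr =>
    obtain ⟨u, hu, rfl⟩ := hr
    rw [Finset.sum_eq_single_of_mem u (by simp [hu])]
    · rw [h.ev_E hu]; simp
    · intro z hz hne
      simp only [Finset.mem_filter, Finset.mem_univ, true_and] at hz
      rw [h.ev_E hu, if_neg, zero_smul]
      intro hle
      exact hne (h.eq_of le_rfl hle (hz.trans hu.symm))
  | zero => simp
  | add a b _ _ ha hb =>
    conv_lhs => rw [ha, hb]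
    rw [← Finset.sum_add_distrib]
    apply Finset.sum_congr rfl
    intro z _
    rw [map_add, add_smul]
  | smul c a _ ha =>
    conv_lhs => rw [ha]
    rw [Finset.smul_sum]
    apply Finset.sum_congr rfl
    intro z _
    rw [map_smul, smul_assoc]

/-- Elements of a graded piece are determined by the evaluations. -/
lemma SPos.ext_ev (h : SPos x) {b : Fin n → ℕ} {r r' : FaceRing P k}
    (hr : r ∈ facePiece P k n x (fun j => (b j : ℤ)))
    (hr' : r' ∈ facePiece P k n x (fun j => (b j : ℤ)))
    (he : ∀ z, sp x z = spb b → h.ev k z r = h.ev k z r') : r = r' := by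
  rw [h.repr hr, h.repr hr']
  apply Finset.sum_congr rfl
  intro z hz
  simp only [Finset.mem_filter, Finset.mem_univ, true_and] at hz
  rw [he z hz]

/-- Any values of the evaluations are realized. -/
lemma SPos.exists_ev (h : SPos x) (b : Fin n → ℕ) (g : P → k) :
    ∃ r ∈ facePiece P k n x (fun j => (b j : ℤ)), ∀ z, sp x z = spb b → h.ev k z r = g z := by
  refine ⟨∑ z ∈ Finset.univ.filter (fun z => sp x z = spb b), g z • E k x z b, ?_, ?_⟩
  · apply Submodule.sum_mem
    intro z hz
    simp only [Finset.mem_filter, Finset.mem_univ, true_and] at hz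
    exact Submodule.smul_mem _ _ (h.E_facePiece hz)
  · intro u hu
    rw [map_sum, Finset.sum_eq_single_of_mem u (by simp [hu])]
    · rw [map_smul, h.ev_E hu]; simp
    · intro z hz hne
      simp only [Finset.mem_filter, Finset.mem_univ, true_and] at hz
      rw [map_smul, h.ev_E hz, if_neg, smul_zero]
      intro hle
      exact hne (h.eq_of hle le_rfl (hz.trans hu.symm))

end Ring

section Abstract
variable {k : Type} [Field k]

lemma quot_bij {V W : Type*} [AddCommGroup V] [Module k V] [AddCommGroup W] [Module k W]
    (Z B : Submodule k V) (Z' B' : Submodule k W) (g : ↥Z →ₗ[k] ↥Z')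
    (hle : Submodule.comap Z.subtype B ≤ (Submodule.comap Z'.subtype B').comap g)
    (hB : ∀ v : ↥Z, (g v : W) ∈ B' → (v : V) ∈ B)
    (hs : ∀ y : ↥Z', ∃ v : ↥Z, (y : W) - (g v : W) ∈ B') :
    Function.Bijective (Submodule.mapQ (Submodule.comap Z.subtype B)
      (Submodule.comap Z'.subtype B') g hle) := by
  constructor
  · rw [← LinearMap.ker_eq_bot, LinearMap.ker_eq_bot']
    intro q hq
    obtain ⟨v, rfl⟩ := Submodule.Quotient.mk_surjective _ q
    rw [Submodule.mapQ_apply, Submodule.Quotient.mk_eq_zero] at hq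
    rw [Submodule.Quotient.mk_eq_zero]
    exact hB v hq
  · intro q
    obtain ⟨y, rfl⟩ := Submodule.Quotient.mk_surjective _ q
    obtain ⟨v, hv⟩ := hs y
    refine ⟨Submodule.Quotient.mk v, ?_⟩
    rw [Submodule.mapQ_apply]
    symm
    rw [Submodule.Quotient.eq]
    exact hv

lemma quot_equiv {V W : Type*} [AddCommGroup V] [Module k V] [AddCommGroup W] [Module k W]
    (Z B : Submodule k V) (Z' B' : Submodule k W) (f : V →ₗ[k] W)
    (hZ : ∀ v ∈ Z, f v ∈ Z') (hB : ∀ v ∈ Z, f v ∈ B' ↔ v ∈ B)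
    (hs : ∀ y ∈ Z', ∃ v ∈ Z, y - f v ∈ B') :
    Nonempty ((↥Z ⧸ Submodule.comap Z.subtype B) ≃ₗ[k] (↥Z' ⧸ Submodule.comap Z'.subtype B')) := by
  have hle : Submodule.comap Z.subtype B ≤
      (Submodule.comap Z'.subtype B').comap (f.restrict hZ) := by
    intro v hv
    exact (hB v.1 v.2).2 hv
  refine ⟨LinearEquiv.ofBijective _ (quot_bij Z B Z' B' (f.restrict hZ) hle ?_ ?_)⟩
  · intro v hv
    exact (hB v.1 v.2).1 hv
  · intro y
    obtain ⟨v, hv, h⟩ := hs y.1 y.2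
    exact ⟨⟨v, hv⟩, h⟩

lemma quot_pi {ι : Type*} {V : ι → Type*} [∀ i, AddCommGroup (V i)] [∀ i, Module k (V i)]
    (Z B : ∀ i, Submodule k (V i)) :
    Nonempty ((↥(Submodule.pi Set.univ Z) ⧸
        Submodule.comap (Submodule.pi Set.univ Z).subtype (Submodule.pi Set.univ B)) ≃ₗ[k]
      (∀ i, ↥(Z i) ⧸ Submodule.comap (Z i).subtype (B i))) := by
  let r : ∀ i, ↥(Submodule.pi Set.univ Z) →ₗ[k] ↥(Z i) := fun i =>
    ((LinearMap.proj i).comp (Submodule.pi Set.univ Z).subtype).codRestrict (Z i)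
      (fun v => v.2 i (Set.mem_univ i))
  let φ : ↥(Submodule.pi Set.univ Z) →ₗ[k] (∀ i, ↥(Z i) ⧸ Submodule.comap (Z i).subtype (B i)) :=
    LinearMap.pi fun i => (Submodule.mkQ _).comp (r i)
  have hk : Submodule.comap (Submodule.pi Set.univ Z).subtype (Submodule.pi Set.univ B) =
      LinearMap.ker φ := by
    ext v
    rw [LinearMap.mem_ker]
    constructor
    · intro hv
      funext i
      change Submodule.Quotient.mk (r i v) = 0
      rw [Submodule.Quotient.mk_eq_zero]
      exact hv i (Set.mem_univ i)
    · intro hv i _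
      have := congrFun hv i
      change Submodule.Quotient.mk (r i v) = 0 at this
      rw [Submodule.Quotient.mk_eq_zero] at this
      exact this
  have hsurj : Function.Surjective φ := by
    intro q
    choose y hy using fun i => Submodule.Quotient.mk_surjective _ (q i)
    refine ⟨⟨fun i => (y i).1, fun i _ => (y i).2⟩, ?_⟩
    funext i
    rw [← hy i]
    rfl
  exact ⟨(Submodule.quotEquivOfEq _ _ hk).trans (φ.quotKerEquivOfSurjective hsurj)⟩

lemma qis {V W : Type*} [AddCommGroup V] [Module k V] [AddCommGroup W] [Module k W]
    (d : V →ₗ[k] V) (d' : W →ₗ[k] W) (G : ℤ → Submodule k V) (G' : ℤ → Submodule k W)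
    (f : V →ₗ[k] W)
    (hf : ∀ t, ∀ v ∈ G t, f v ∈ G' t)
    (hs : ∀ t, ∀ w ∈ G' t, ∃ v ∈ G t, f v = w)
    (hc : ∀ t, ∀ v ∈ G t, f (d v) = d' (f v))
    (hd : ∀ t, ∀ v ∈ G t, d v ∈ G (t + 1))
    (hdd : ∀ v, d (d v) = 0)
    (hk : ∀ t, ∀ v ∈ G t, f v = 0 → d v = 0 → ∃ u ∈ G (t - 1), f u = 0 ∧ d u = v) (t : ℤ) :
    Nonempty ((↥(LinearMap.ker d ⊓ G t) ⧸
        Submodule.comap (LinearMap.ker d ⊓ G t).subtype (Submodule.map d (G (t - 1)))) ≃ₗ[k]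
      (↥(LinearMap.ker d' ⊓ G' t) ⧸
        Submodule.comap (LinearMap.ker d' ⊓ G' t).subtype (Submodule.map d' (G' (t - 1))))) := by
  apply quot_equiv _ _ _ _ f
  · rintro v ⟨hv, hvt⟩
    refine ⟨?_, hf t v hvt⟩
    rw [SetLike.mem_coe, LinearMap.mem_ker] at *
    rw [← hc t v hvt, hv, map_zero]
  · rintro v ⟨hv, hvt⟩
    rw [SetLike.mem_coe, LinearMap.mem_ker] at hv
    constructor
    · rintro ⟨w, hw, hwv⟩
      obtain ⟨u, hu, rfl⟩ := hs _ w hw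
      rw [← hc _ u hu] at hwv
      have h1 : d u ∈ G t := by
        have := hd _ u hu
        rwa [sub_add_cancel] at this
      obtain ⟨u', hu', -, h2⟩ := hk t (v - d u) (Submodule.sub_mem _ hvt h1)
        (by rw [map_sub, hwv, sub_self]) (by rw [map_sub, hv, hdd, sub_self])
      exact ⟨u + u', Submodule.add_mem _ hu hu', by rw [map_add, h2]; abel⟩
    · rintro ⟨u, hu, rfl⟩
      exact ⟨f u, hf _ u hu, (hc _ u hu).symm⟩
  · rintro w ⟨hw, hwt⟩
    rw [SetLike.mem_coe, LinearMap.mem_ker] at hw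
    obtain ⟨v, hv, rfl⟩ := hs t w hwt
    obtain ⟨u, hu, hfu, hdu⟩ := hk (t + 1) (d v) (hd t v hv) (by rw [hc t v hv, hw]) (hdd v)
    rw [add_sub_cancel_right] at hu
    refine ⟨v - u, ⟨?_, Submodule.sub_mem _ hv hu⟩, ?_⟩
    · rw [SetLike.mem_coe, LinearMap.mem_ker, map_sub, hdu, sub_self]
    · rw [map_sub, hfu, sub_zero, sub_self]
      exact Submodule.zero_mem _

lemma acyc {V : Type*} [AddCommGroup V] [Module k V] (d h : V →ₗ[k] V) (G : ℤ → Submodule k V)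
    (F : ℕ → Submodule k V) (N : ℕ)
    (hd : ∀ t, ∀ v ∈ G t, d v ∈ G (t + 1))
    (hh : ∀ t, ∀ v ∈ G t, h v ∈ G (t - 1))
    (hdd : ∀ v, d (d v) = 0)
    (h0 : F 0 = ⊤)
    (hN : ∀ t, ∀ v ∈ G t, v ∈ F N → v = 0)
    (hF : ∀ t m, ∀ v ∈ G t, v ∈ F m → v - d (h v) - h (d v) ∈ F (m + 1))
    (t : ℤ) (v : V) (hv : v ∈ G t) (hdv : d v = 0) : ∃ u ∈ G (t - 1), d u = v := by
  suffices H : ∀ m, ∀ v ∈ G t, d v = 0 → v ∈ F (N - m) → ∃ u ∈ G (t - 1), d u = v by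
    apply H N v hv hdv
    rw [Nat.sub_self, h0]; trivial
  intro m
  induction m with
  | zero =>
    intro v hv _ hF0
    have := hN t v hv hF0
    exact ⟨0, Submodule.zero_mem _, by rw [this, map_zero]⟩
  | succ m ih =>
    intro v hv hdv hvF
    by_cases hm : m < N
    · have h1 := hF t _ v hv hvF
      rw [hdv, map_zero, sub_zero, show N - (m + 1) + 1 = N - m by omega] at h1
      have h2 : d (h v) ∈ G t := by
        have := hd _ _ (hh t v hv)
        rwa [sub_add_cancel] at this
      obtain ⟨u, hu, hu'⟩ := ih (v - d (h v)) (Submodule.sub_mem _ hv h2)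
        (by rw [map_sub, hdv, hdd, sub_self]) h1
      exact ⟨u + h v, Submodule.add_mem _ hu (hh t v hv), by rw [map_add, hu']; abel⟩
    · apply ih v hv hdv
      rwa [show N - m = N - (m + 1) by omega]

end Abstract

section DirLim
variable {P : Type} [Fintype P] [PartialOrder P] [OrderBot P] {n : ℕ} {k : Type} [Field k]
variable {x : Fin n → P} {t : ℕ} {α : Fin n → ℤ}

lemma transChain_self (i : ℕ) (v : ExtPiece P k n x i t α) :
    transChain P k n x t α (le_refl i) v = v := by
  unfold transChain
  rw [Nat.leRecOn_self]
  rfl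

lemma transChain_succ {i j : ℕ} (h : i ≤ j) (h' : i ≤ j + 1) (v : ExtPiece P k n x i t α) :
    transChain P k n x t α h' v = transExt P k n x j t α (transChain P k n x t α h v) := by
  unfold transChain
  rw [Nat.leRecOn_succ h]
  rfl

lemma transChain_trans {i j l : ℕ} (h : i ≤ j) (h' : j ≤ l) (v : ExtPiece P k n x i t α) :
    transChain P k n x t α h' (transChain P k n x t α h v) =
      transChain P k n x t α (h.trans h') v := by
  induction l, h' using Nat.le_induction with
  | base => rw [transChain_self]
  | succ l hl ih => rw [transChain_succ hl, ih, transChain_succ (h.trans hl)]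

instance : DirectedSystem (fun ℓ => ExtPiece P k n x ℓ t α)
    (fun _ _ h => transChain P k n x t α h) where
  map_self _ _ := transChain_self _ _
  map_map _ _ _ _ _ _ := transChain_trans _ _ _

lemma transChain_bij (ℓ₀ : ℕ)
    (hb : ∀ ℓ, ℓ₀ ≤ ℓ → Function.Bijective (transExt P k n x ℓ t α)) {j : ℕ} (h : ℓ₀ ≤ j) :
    Function.Bijective (transChain P k n x t α h) := by
  induction j, h using Nat.le_induction with
  | base =>
    have : ⇑(transChain P k n x t α (le_refl ℓ₀)) = id := funext (transChain_self ℓ₀)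
    rw [this]; exact Function.bijective_id
  | succ j hj ih =>
    have : ⇑(transChain P k n x t α (hj.trans (Nat.le_succ j))) =
        ⇑(transExt P k n x j t α) ∘ ⇑(transChain P k n x t α hj) :=
      funext (transChain_succ hj _)
    rw [this]; exact (hb j hj).comp ih

lemma locCoh_equiv (ℓ₀ : ℕ)
    (hb : ∀ ℓ, ℓ₀ ≤ ℓ → Function.Bijective (transExt P k n x ℓ t α)) :
    Nonempty (LocCoh P k n x t α ≃ₗ[k] ExtPiece P k n x ℓ₀ t α) := by
  let o : ExtPiece P k n x ℓ₀ t α →ₗ[k] LocCoh P k n x t α :=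
    Module.DirectLimit.of k ℕ (fun ℓ => ExtPiece P k n x ℓ t α)
      (fun _ _ h => transChain P k n x t α h) ℓ₀
  have ho : Function.Bijective o := by
    constructor
    · intro u v hv
      obtain ⟨j, hj, h⟩ := Module.DirectLimit.exists_eq_of_of_eq hv
      exact (transChain_bij ℓ₀ hb hj).1 h
    · intro q
      obtain ⟨i, v, rfl⟩ := Module.DirectLimit.exists_of q
      obtain ⟨u, hu⟩ := (transChain_bij ℓ₀ hb (le_max_right i ℓ₀)).2
        (transChain P k n x t α (le_max_left i ℓ₀) v)
      refine ⟨u, ?_⟩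
      have h1 := Module.DirectLimit.of_f (R := k) (G := fun ℓ => ExtPiece P k n x ℓ t α)
        (f := fun _ _ h => transChain P k n x t α h) (hij := le_max_right i ℓ₀) (x := u)
      have h2 := Module.DirectLimit.of_f (R := k) (G := fun ℓ => ExtPiece P k n x ℓ t α)
        (f := fun _ _ h => transChain P k n x t α h) (hij := le_max_left i ℓ₀) (x := v)
      exact (h1.symm.trans (congrArg _ hu)).trans h2
  exact ⟨(LinearEquiv.ofBijective o ho).symm⟩

lemma locCoh_sub (ℓ₀ : ℕ) (hb : ∀ ℓ, ℓ₀ ≤ ℓ → Subsingleton (ExtPiece P k n x ℓ t α)) :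
    Subsingleton (LocCoh P k n x t α) := by
  have H : ∀ q : LocCoh P k n x t α, q = 0 := by
    intro q
    obtain ⟨i, v, rfl⟩ := Module.DirectLimit.exists_of q
    have h2 := Module.DirectLimit.of_f (R := k) (G := fun ℓ => ExtPiece P k n x ℓ t α)
        (f := fun _ _ h => transChain P k n x t α h) (hij := le_max_left i ℓ₀) (x := v)
    have := hb _ (le_max_right i ℓ₀)
    have h3 : transChain P k n x t α (le_max_left i ℓ₀) v = 0 := Subsingleton.elim _ _
    rw [← h2, h3, map_zero]
  exact ⟨fun a b => (H a).trans (H b).symm⟩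

end DirLim

section Sign
variable {k : Type} [Field k] {Λ : Type*} [PartialOrder Λ] [DecidableEq Λ]

/-- The sign of `j` in `A`. -/
def eps (k : Type) [Field k] (A : Finset Λ) (j : Λ) : k :=
  (-1 : k) ^ ((A.filter fun i => i < j).card)

lemma eps_def (A : Finset Λ) (j : Λ) [DecidablePred fun i => i < j] :
    (-1 : k) ^ ((A.filter fun i => i < j).card) = eps k A j := by
  unfold eps; congr!

lemma eps_sq (A : Finset Λ) (j : Λ) : eps k A j * eps k A j = 1 := by
  unfold eps
  rw [← pow_add, ← two_mul, pow_mul]; simp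

lemma eps_insert {A : Finset Λ} {i : Λ} (hi : i ∉ A) (j : Λ) :
    eps k (insert i A) j = if i < j then - eps k A j else eps k A j := by
  unfold eps
  rw [Finset.filter_insert]
  split_ifs with h
  · rw [Finset.card_insert_of_notMem (by simp [hi]), pow_succ]; ring
  · rfl

lemma eps_erase {A : Finset Λ} {i : Λ} (hi : i ∈ A) (j : Λ) :
    eps k (A.erase i) j = if i < j then - eps k A j else eps k A j := by
  have := eps_insert (k := k) (Finset.notMem_erase i A) j
  rw [Finset.insert_erase hi] at this
  rw [this]
  split_ifs <;> simp

lemma eps_anti {A : Finset Λ} {i j : Λ} (hi : i ∈ A) (hj : j ∈ A) (hij : i < j ∨ j < i) :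
    eps k A j * eps k (A.erase j) i + eps k A i * eps k (A.erase i) j = 0 := by
  rw [eps_erase hj, eps_erase hi]
  rcases hij with h | h
  · rw [if_pos h, if_neg h.not_gt]; ring
  · rw [if_pos h, if_neg h.not_gt]; ring

lemma eps_dd {A T : Finset Λ} (hT : T ⊆ A) (hA : ∀ i ∈ T, ∀ j ∈ T, i ≠ j → i < j ∨ j < i)
    (F : Λ → Λ → k) (hF : ∀ i j, F i j = F j i) :
    ∑ j ∈ T, eps k A j * ∑ i ∈ T.erase j, eps k (A.erase j) i * F j i = 0 := by
  simp_rw [Finset.mul_sum]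
  rw [Finset.sum_sigma']
  apply Finset.sum_involution (fun a _ => (⟨a.2, a.1⟩ : (_ : Λ) × Λ))
  · rintro ⟨j, i⟩ h
    simp only [Finset.mem_sigma, Finset.mem_erase] at h
    obtain ⟨hj, hne, hi⟩ := h
    have := eps_anti (k := k) (hT hi) (hT hj) (hA i hi j hj hne)
    simp only
    rw [hF j i, ← mul_assoc, ← mul_assoc, ← add_mul, this, zero_mul]
  · rintro ⟨j, i⟩ h _ heq
    simp only [Finset.mem_sigma, Finset.mem_erase] at h
    simp only [Sigma.mk.injEq] at heq
    exact h.2.1 heq.1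
  · rintro ⟨j, i⟩ h
    simp only [Finset.mem_sigma, Finset.mem_erase] at h ⊢
    exact ⟨h.2.2, h.2.1.symm, h.1⟩
  · rintro ⟨j, i⟩ h
    rfl

end Sign

section Total
variable {P : Type} [Fintype P] [PartialOrder P] [OrderBot P] {n : ℕ} {k : Type} [Field k]
variable {x : Fin n → P} {S : Finset (Fin n)}

/-- The pairs indexing the total complex. -/
def Xp (x : Fin n → P) (S : Finset (Fin n)) (z : P) (c : Finset P) : Prop :=
  S ⊆ sp x z ∧ IsChain (· ≤ ·) (↑c : Set P) ∧ ∀ u ∈ c, z ≤ u ∧ sp x u ≠ S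

/-- The cellular differential. -/
def d1 (x : Fin n → P) (S : Finset (Fin n)) (g : P → Finset P → k) (z : P) (c : Finset P) : k :=
  ∑ j ∈ sp x z \ S, eps k (sp x z) j * g (er x z j) c

/-- The chain differential. -/
def d2 (g : P → Finset P → k) (z : P) (c : Finset P) : k :=
  ∑ v ∈ c, eps k c v * g z (c.erase v)

/-- The total differential. -/
def dT (k : Type) [Field k] (x : Fin n → P) (S : Finset (Fin n)) :
    (P → Finset P → k) →ₗ[k] (P → Finset P → k) where
  toFun g z c := if Xp x S z c then (-1) ^ c.card * d1 x S g z c + d2 g z c else 0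
  map_add' g g' := by
    funext z c
    simp only [Pi.add_apply]
    split_ifs
    · simp only [d1, d2, Pi.add_apply, mul_add, Finset.sum_add_distrib]; ring
    · simp
  map_smul' a g := by
    funext z c
    simp only [Pi.smul_apply, smul_eq_mul, RingHom.id_apply]
    split_ifs
    · have h1 : d1 x S (a • g) z c = a * d1 x S g z c := by
        simp only [d1, Pi.smul_apply, smul_eq_mul, Finset.mul_sum]
        exact Finset.sum_congr rfl fun j _ => by ring
      have h2 : d2 (a • g) z c = a * d2 g z c := by
        simp only [d2, Pi.smul_apply, smul_eq_mul, Finset.mul_sum]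
        exact Finset.sum_congr rfl fun j _ => by ring
      rw [h1, h2]; ring
    · simp

lemma dT_apply (g : P → Finset P → k) (z : P) (c : Finset P) :
    dT k x S g z c = if Xp x S z c then (-1) ^ c.card * d1 x S g z c + d2 g z c else 0 := rfl

/-- Graded pieces of the total complex. -/
def GT (k : Type) [Field k] (x : Fin n → P) (S : Finset (Fin n)) (t : ℤ) :
    Submodule k (P → Finset P → k) where
  carrier := {g | ∀ z c, g z c ≠ 0 → Xp x S z c ∧ ((sp x z).card : ℤ) + (c.card : ℤ) = t}
  add_mem' := by
    intro a b ha hb z c h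
    by_cases h1 : a z c = 0
    · apply hb z c
      intro h2
      simp [h1, h2] at h
    · exact ha z c h1
  zero_mem' := by intro z c h; simp at h
  smul_mem' := by
    intro r a ha z c h
    apply ha z c
    intro h2
    simp [h2] at h

lemma Xp.erase_chain {z : P} {c : Finset P} (h : Xp x S z c) (v : P) : Xp x S z (c.erase v) :=
  ⟨h.1, h.2.1.mono (by simp), fun u hu => h.2.2 u (Finset.mem_of_mem_erase hu)⟩

lemma SPos.Xp_er (hx : SPos x) {z : P} {c : Finset P} (h : Xp x S z c) {j : Fin n} (hj : j ∉ S) :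
    Xp x S (er x z j) c := by
  refine ⟨?_, h.2.1, fun u hu => ⟨(hx.er_le z j).trans (h.2.2 u hu).1, (h.2.2 u hu).2⟩⟩
  rw [hx.sp_er]
  exact fun i hi => Finset.mem_erase.2 ⟨fun hij => hj (hij ▸ hi), h.1 hi⟩

lemma chain_lt {c : Finset P} (h : IsChain (· ≤ ·) (↑c : Set P)) {i j : P} (hi : i ∈ c)
    (hj : j ∈ c) (hne : i ≠ j) : i < j ∨ j < i := by
  rcases h (Finset.mem_coe.2 hi) (Finset.mem_coe.2 hj) hne with h1 | h1
  · exact Or.inl (lt_of_le_of_ne h1 hne)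
  · exact Or.inr (lt_of_le_of_ne h1 hne.symm)

lemma SPos.dT_dT (hx : SPos x) (g : P → Finset P → k) : dT k x S (dT k x S g) = 0 := by
  funext z c
  rw [dT_apply]
  split_ifs with hX
  swap
  · rfl
  have e1 : d1 x S (dT k x S g) z c =
      ∑ j ∈ sp x z \ S, eps k (sp x z) j * d2 g (er x z j) c := by
    have hz : ∑ j ∈ sp x z \ S, eps k (sp x z) j *
        ∑ i ∈ (sp x z \ S).erase j, eps k ((sp x z).erase j) i * g (er x (er x z j) i) c = 0 :=
      eps_dd Finset.sdiff_subset (fun i _ j _ hij => lt_or_gt_of_ne hij)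
        (fun j i => g (er x (er x z j) i) c) (fun i j => by rw [hx.er_er])
    have : ∑ j ∈ sp x z \ S, eps k (sp x z) j * d2 g (er x z j) c =
        (-1) ^ c.card * 0 + ∑ j ∈ sp x z \ S, eps k (sp x z) j * d2 g (er x z j) c := by
      rw [mul_zero, zero_add]
    rw [this, ← hz, Finset.mul_sum, ← Finset.sum_add_distrib, d1]
    apply Finset.sum_congr rfl
    intro j hj
    have hjS := (Finset.mem_sdiff.1 hj).2
    rw [dT_apply, if_pos (hx.Xp_er hX hjS), d1, hx.sp_er, Finset.erase_sdiff_comm]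
    ring
  have e2 : d2 (dT k x S g) z c =
      ∑ v ∈ c, eps k c v * (-(-1) ^ c.card * d1 x S g z (c.erase v)) := by
    have hz : ∑ v ∈ c, eps k c v *
        ∑ u ∈ c.erase v, eps k (c.erase v) u * g z ((c.erase v).erase u) = 0 :=
      eps_dd (Finset.Subset.refl c) (fun i hi j hj hij => chain_lt hX.2.1 hi hj hij)
        (fun v u => g z ((c.erase v).erase u)) (fun i j => by rw [Finset.erase_right_comm])
    rw [← add_zero (∑ v ∈ c, eps k c v * (-(-1) ^ c.card * d1 x S g z (c.erase v))), ← hz,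
      ← Finset.sum_add_distrib, d2]
    apply Finset.sum_congr rfl
    intro v hv
    rw [dT_apply, if_pos (hX.erase_chain v), d2, ← Finset.card_erase_add_one hv, pow_succ]
    ring
  rw [e1, e2]
  simp only [d1, d2, Finset.mul_sum]
  rw [Finset.sum_comm, ← Finset.sum_add_distrib]
  apply Finset.sum_eq_zero
  intro v _
  rw [← Finset.sum_add_distrib]
  apply Finset.sum_eq_zero
  intro j _
  ring

lemma SPos.card_er (hx : SPos x) {z : P} {j : Fin n} (hj : j ∈ sp x z) :
    (sp x (er x z j)).card + 1 = (sp x z).card := by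
  rw [hx.sp_er, Finset.card_erase_add_one hj]

lemma SPos.dT_GT (hx : SPos x) (t : ℤ) (g : P → Finset P → k) (hg : g ∈ GT k x S t) :
    dT k x S g ∈ GT k x S (t + 1) := by
  intro z c h
  rw [dT_apply] at h
  have hX : Xp x S z c := by
    by_contra hX
    rw [if_neg hX] at h
    exact h rfl
  refine ⟨hX, ?_⟩
  by_contra hne
  apply h
  rw [if_pos hX]
  have e1 : d1 x S g z c = 0 := by
    apply Finset.sum_eq_zero
    intro j hj
    have hj := (Finset.mem_sdiff.1 hj).1
    by_contra h0
    have := (hg _ _ (right_ne_zero_of_mul h0)).2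
    have h2 := hx.card_er hj
    omega
  have e2 : d2 g z c = 0 := by
    apply Finset.sum_eq_zero
    intro v hv
    by_contra h0
    have := (hg _ _ (right_ne_zero_of_mul h0)).2
    have h2 := Finset.card_erase_add_one hv
    omega
  rw [e1, e2, mul_zero, add_zero]

/-- Subcomplex of cochains vanishing on pairs with support of `z` equal to `S`. -/
def GA (k : Type) [Field k] (x : Fin n → P) (S : Finset (Fin n)) (t : ℤ) :
    Submodule k (P → Finset P → k) where
  carrier := {g | g ∈ GT k x S t ∧ ∀ z c, sp x z = S → g z c = 0}
  add_mem' := by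
    intro a b ha hb
    exact ⟨Submodule.add_mem _ ha.1 hb.1, fun z c h => by
      rw [Pi.add_apply, Pi.add_apply, ha.2 z c h, hb.2 z c h, add_zero]⟩
  zero_mem' := ⟨Submodule.zero_mem _, fun _ _ _ => rfl⟩
  smul_mem' := by
    intro r a ha
    exact ⟨Submodule.smul_mem _ _ ha.1, fun z c h => by
      rw [Pi.smul_apply, Pi.smul_apply, ha.2 z c h, smul_zero]⟩

/-- Filtration by the rank of `z`. -/
def FA (k : Type) [Field k] (x : Fin n → P) (m : ℕ) : Submodule k (P → Finset P → k) where
  carrier := {g | ∀ z c, (sp x z).card < m → g z c = 0}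
  add_mem' := by
    intro a b ha hb z c h
    rw [Pi.add_apply, Pi.add_apply, ha z c h, hb z c h, add_zero]
  zero_mem' := fun _ _ _ => rfl
  smul_mem' := by
    intro r a ha z c h
    rw [Pi.smul_apply, Pi.smul_apply, ha z c h, smul_zero]

/-- Contraction inserting `z` into the chain. -/
def hA (k : Type) [Field k] (x : Fin n → P) (S : Finset (Fin n)) :
    (P → Finset P → k) →ₗ[k] (P → Finset P → k) where
  toFun g z c := if Xp x S z c ∧ sp x z ≠ S ∧ z ∉ c then g z (insert z c) else 0
  map_add' g g' := by
    funext z c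
    simp only [Pi.add_apply]
    split_ifs <;> simp
  map_smul' a g := by
    funext z c
    simp only [Pi.smul_apply, smul_eq_mul, RingHom.id_apply]
    split_ifs <;> simp

lemma hA_apply (g : P → Finset P → k) (z : P) (c : Finset P) :
    hA k x S g z c = if Xp x S z c ∧ sp x z ≠ S ∧ z ∉ c then g z (insert z c) else 0 := rfl

lemma Xp.insert_chain {z : P} {c : Finset P} (h : Xp x S z c) (hz : sp x z ≠ S) :
    Xp x S z (insert z c) := by
  refine ⟨h.1, ?_, ?_⟩
  · rw [Finset.coe_insert]
    exact h.2.1.insert fun b hb _ => Or.inl (h.2.2 b hb).1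
  · intro u hu
    rcases Finset.mem_insert.1 hu with rfl | hu
    · exact ⟨le_rfl, hz⟩
    · exact h.2.2 u hu

lemma SPos.acycA (hx : SPos x) (t : ℤ) (v : P → Finset P → k) (hv : v ∈ GA k x S t)
    (hdv : dT k x S v = 0) : ∃ u ∈ GA k x S (t - 1), dT k x S u = v := by
  refine acyc (dT k x S) (hA k x S) (GA k x S) (FA k x) (n + 1) ?_ ?_ hx.dT_dT ?_ ?_ ?_ t v hv hdv
  · intro t v hv
    refine ⟨hx.dT_GT t v hv.1, fun z c hz => ?_⟩
    rw [dT_apply]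
    split_ifs
    · have e1 : d1 x S v z c = 0 := by rw [d1, hz]; simp
      have e2 : d2 v z c = 0 := by
        apply Finset.sum_eq_zero
        intro u _
        rw [hv.2 z _ hz, mul_zero]
      rw [e1, e2, mul_zero, add_zero]
    · rfl
  · intro t v hv
    refine ⟨fun z c h => ?_, fun z c hz => ?_⟩
    · rw [hA_apply] at h
      by_cases hc : Xp x S z c ∧ sp x z ≠ S ∧ z ∉ c
      · rw [if_pos hc] at h
        refine ⟨hc.1, ?_⟩
        have := (hv.1 _ _ h).2
        rw [Finset.card_insert_of_notMem hc.2.2] at this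
        push_cast at this
        omega
      · rw [if_neg hc] at h
        exact absurd rfl h
    · rw [hA_apply, if_neg]
      exact fun h => h.2.1 hz
  · ext v
    simp only [Submodule.mem_top, iff_true]
    intro z c h
    exact absurd h (Nat.not_lt_zero _)
  · intro t v _ hF
    funext z c
    apply hF z c
    have := Finset.card_le_univ (sp x z)
    rw [Fintype.card_fin] at this
    omega
  · intro t m v hv hF z c hm
    change v z c - dT k x S (hA k x S v) z c - hA k x S (dT k x S v) z c = 0
    by_cases hX : Xp x S z c
    swap
    · have h1 : v z c = 0 := by
        by_contra h0
        exact hX (hv.1 _ _ h0).1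
      rw [h1, dT_apply, if_neg hX, hA_apply, if_neg (fun h => hX h.1)]
      simp
    by_cases hS : sp x z = S
    · have h1 : v z c = 0 := hv.2 z c hS
      have h2 : d1 x S (hA k x S v) z c = 0 := by rw [d1, hS]; simp
      have h3 : d2 (hA k x S v) z c = 0 := by
        apply Finset.sum_eq_zero
        intro u _
        rw [hA_apply, if_neg (fun h => h.2.1 hS), mul_zero]
      rw [h1, dT_apply, if_pos hX, h2, h3, hA_apply, if_neg (fun h => h.2.1 hS)]
      simp
    have hlow : ∀ j ∈ sp x z, ∀ c', v (er x z j) c' = 0 := by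
      intro j hj c'
      apply hF
      have := hx.card_er hj
      omega
    have h2 : d1 x S (hA k x S v) z c = 0 := by
      apply Finset.sum_eq_zero
      intro j hj
      rw [hA_apply, hlow j (Finset.mem_sdiff.1 hj).1]
      simp
    rw [dT_apply, if_pos hX, h2, mul_zero, zero_add]
    by_cases hzc : z ∈ c
    · rw [hA_apply _ z c, if_neg (fun h => h.2.2 hzc), sub_zero, sub_eq_zero, d2,
        Finset.sum_eq_single_of_mem z hzc]
      · rw [hA_apply, if_pos ⟨hX.erase_chain z, hS, Finset.notMem_erase z c⟩,
          Finset.insert_erase hzc]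
        have : eps k c z = 1 := by
          unfold eps
          rw [Finset.filter_eq_empty_iff.2, Finset.card_empty, pow_zero]
          intro u hu
          exact fun hlt => absurd (hX.2.2 u hu).1 hlt.not_ge
        rw [this, one_mul]
      · intro u hu hne
        rw [hA_apply, if_neg, mul_zero]
        exact fun h => h.2.2 (Finset.mem_erase.2 ⟨hne.symm, hzc⟩)
    · have hX' := hX.insert_chain hS
      have h3 : d1 x S v z (insert z c) = 0 := by
        apply Finset.sum_eq_zero
        intro j hj
        rw [hlow j (Finset.mem_sdiff.1 hj).1]
        simp
      rw [hA_apply _ z c, if_pos ⟨hX, hS, hzc⟩, dT_apply, if_pos hX', h3, mul_zero, zero_add,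
        d2, d2, Finset.sum_insert hzc, Finset.erase_insert hzc]
      have : eps k (insert z c) z = 1 := by
        unfold eps
        rw [Finset.filter_eq_empty_iff.2, Finset.card_empty, pow_zero]
        intro u hu
        exact fun hlt => absurd (hX'.2.2 u hu).1 hlt.not_ge
      rw [this, one_mul]
      have h4 : ∑ u ∈ c, eps k c u * hA k x S v z (c.erase u) +
          ∑ u ∈ c, eps k (insert z c) u * v z ((insert z c).erase u) = 0 := by
        rw [← Finset.sum_add_distrib]
        apply Finset.sum_eq_zero
        intro u hu
        have hne : z ≠ u := fun h => hzc (h ▸ hu)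
        have hlt : z < u := lt_of_le_of_ne (hX.2.2 u hu).1 hne
        rw [hA_apply, if_pos ⟨hX.erase_chain u, hS, fun h => hzc (Finset.mem_of_mem_erase h)⟩,
          eps_insert hzc, if_pos hlt, Finset.erase_insert_of_ne hne]
        ring
      linear_combination -h4

/-- Subcomplex of cochains vanishing on the empty chain. -/
def GB (k : Type) [Field k] (x : Fin n → P) (S : Finset (Fin n)) (t : ℤ) :
    Submodule k (P → Finset P → k) where
  carrier := {g | g ∈ GT k x S t ∧ ∀ z, g z ∅ = 0}
  add_mem' := by
    intro a b ha hb
    exact ⟨Submodule.add_mem _ ha.1 hb.1, fun z => by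
      rw [Pi.add_apply, Pi.add_apply, ha.2 z, hb.2 z, add_zero]⟩
  zero_mem' := ⟨Submodule.zero_mem _, fun _ => rfl⟩
  smul_mem' := by
    intro r a ha
    exact ⟨Submodule.smul_mem _ _ ha.1, fun z => by
      rw [Pi.smul_apply, Pi.smul_apply, ha.2 z, smul_zero]⟩

/-- Filtration by the length of the chain. -/
def FB (P : Type) (k : Type) [Field k] (m : ℕ) : Submodule k (P → Finset P → k) where
  carrier := {g | ∀ z c, c.card < m → g z c = 0}
  add_mem' := by
    intro a b ha hb z c h
    rw [Pi.add_apply, Pi.add_apply, ha z c h, hb z c h, add_zero]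
  zero_mem' := fun _ _ _ => rfl
  smul_mem' := by
    intro r a ha z c h
    rw [Pi.smul_apply, Pi.smul_apply, ha z c h, smul_zero]

/-- The minimum of a nonempty chain. -/
def mn (c : Finset P) : P := Classical.epsilon fun u => u ∈ c ∧ ∀ u' ∈ c, u ≤ u'

lemma mn_spec {c : Finset P} (h : IsChain (· ≤ ·) (↑c : Set P)) (hc : c ≠ ∅) :
    mn c ∈ c ∧ ∀ u' ∈ c, mn c ≤ u' := by
  apply Classical.epsilon_spec (p := fun u => u ∈ c ∧ ∀ u' ∈ c, u ≤ u')
  obtain ⟨u, hu, hmin⟩ := c.exists_minimal (Finset.nonempty_iff_ne_empty.2 hc)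
  refine ⟨u, hu, fun u' hu' => ?_⟩
  by_cases hne : u = u'
  · exact hne.le
  rcases h (Finset.mem_coe.2 hu) (Finset.mem_coe.2 hu') hne with h1 | h1
  · exact h1
  · exact hmin hu' h1

/-- A vertex used for coning. -/
def vt (x : Fin n → P) (S : Finset (Fin n)) (hn : Nonempty (Fin n)) (c : Finset P) : Fin n :=
  Classical.epsilon fun v => v ∈ sp x (mn c) ∧ v ∉ S

lemma vt_spec (hn : Nonempty (Fin n)) {z : P} {c : Finset P} (h : Xp x S z c) (hc : c ≠ ∅) :
    vt x S hn c ∈ sp x (mn c) ∧ vt x S hn c ∉ S := by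
  apply Classical.epsilon_spec (p := fun v => v ∈ sp x (mn c) ∧ v ∉ S)
  have h1 := mn_spec h.2.1 hc
  have h2 := h.2.2 _ h1.1
  have h3 : S ⊂ sp x (mn c) :=
    Finset.ssubset_iff_subset_ne.2 ⟨h.1.trans (sp_mono h2.1), h2.2.symm⟩
  obtain ⟨v, hv, hv'⟩ := Finset.exists_of_ssubset h3
  exact ⟨v, hv, hv'⟩

/-- Contraction adding the coning vertex to `z`. -/
def hB (k : Type) [Field k] (x : Fin n → P) (S : Finset (Fin n)) (hn : Nonempty (Fin n)) :
    (P → Finset P → k) →ₗ[k] (P → Finset P → k) where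
  toFun g z c := if Xp x S z c ∧ c ≠ ∅ ∧ vt x S hn c ∉ sp x z then
    (-1) ^ c.card * (eps k (insert (vt x S hn c) (sp x z)) (vt x S hn c) *
      g (rs x (mn c) (insert (vt x S hn c) (sp x z))) c) else 0
  map_add' g g' := by
    funext z c
    simp only [Pi.add_apply]
    split_ifs
    · ring
    · simp
  map_smul' a g := by
    funext z c
    simp only [Pi.smul_apply, smul_eq_mul, RingHom.id_apply]
    split_ifs
    · ring
    · simp

lemma hB_apply (hn : Nonempty (Fin n)) (g : P → Finset P → k) (z : P) (c : Finset P) :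
    hB k x S hn g z c = if Xp x S z c ∧ c ≠ ∅ ∧ vt x S hn c ∉ sp x z then
    (-1) ^ c.card * (eps k (insert (vt x S hn c) (sp x z)) (vt x S hn c) *
      g (rs x (mn c) (insert (vt x S hn c) (sp x z))) c) else 0 := rfl

lemma neg_one_sq (m : ℕ) : ((-1 : k) ^ m) * (-1) ^ m = 1 := by
  rw [← pow_add, ← two_mul, pow_mul]; simp

lemma SPos.acycB (hx : SPos x) (hn : Nonempty (Fin n)) (t : ℤ) (v : P → Finset P → k)
    (hv : v ∈ GB k x S t)
    (hdv : dT k x S v = 0) : ∃ u ∈ GB k x S (t - 1), dT k x S u = v := by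
  refine acyc (dT k x S) (hB k x S hn) (GB k x S) (FB P k) (Fintype.card P + 1)
    ?_ ?_ hx.dT_dT ?_ ?_ ?_ t v hv hdv
  · intro t v hv
    refine ⟨hx.dT_GT t v hv.1, fun z => ?_⟩
    rw [dT_apply]
    split_ifs
    · have e1 : d1 x S v z ∅ = 0 := by
        apply Finset.sum_eq_zero
        intro u _
        rw [hv.2, mul_zero]
      have e2 : d2 v z ∅ = 0 := by simp [d2]
      rw [e1, e2, mul_zero, add_zero]
    · rfl
  · intro t v hv
    refine ⟨fun z c h => ?_, fun z => ?_⟩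
    · rw [hB_apply] at h
      by_cases hc : Xp x S z c ∧ c ≠ ∅ ∧ vt x S hn c ∉ sp x z
      · rw [if_pos hc] at h
        refine ⟨hc.1, ?_⟩
        have h1 := (hv.1 _ _ (right_ne_zero_of_mul (right_ne_zero_of_mul h))).2
        have h2 := mn_spec hc.1.2.1 hc.2.1
        have h3 := (vt_spec hn hc.1 hc.2.1).1
        rw [hx.sp_rs (Finset.insert_subset h3 (sp_mono (hc.1.2.2 _ h2.1).1)),
          Finset.card_insert_of_notMem hc.2.2] at h1
        push_cast at h1
        omega
      · rw [if_neg hc] at h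
        exact absurd rfl h
    · rw [hB_apply, if_neg]
      exact fun h => h.2.1 rfl
  · ext v
    simp only [Submodule.mem_top, iff_true]
    intro z c h
    exact absurd h (Nat.not_lt_zero _)
  · intro t v _ hF
    funext z c
    apply hF z c
    have := Finset.card_le_univ c
    omega
  · intro t m v hv hF z c hm
    change v z c - dT k x S (hB k x S hn v) z c - hB k x S hn (dT k x S v) z c = 0
    by_cases hX : Xp x S z c
    swap
    · have h1 : v z c = 0 := by
        by_contra h0
        exact hX (hv.1 _ _ h0).1
      rw [h1, dT_apply, if_neg hX, hB_apply, if_neg (fun h => hX h.1)]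
      simp
    by_cases hS : c = ∅
    · subst hS
      have h2 : d1 x S (hB k x S hn v) z ∅ = 0 := by
        apply Finset.sum_eq_zero
        intro j _
        rw [hB_apply, if_neg (fun h => h.2.1 rfl), mul_zero]
      have h3 : d2 (hB k x S hn v) z ∅ = 0 := by simp [d2]
      rw [hv.2, dT_apply, if_pos hX, h2, h3, hB_apply, if_neg (fun h => h.2.1 rfl)]
      simp
    have hlow : ∀ u ∈ c, ∀ z', v z' (c.erase u) = 0 := by
      intro u hu z'
      apply hF
      have := Finset.card_erase_add_one hu
      omega
    have h2 : ∀ z', d2 (hB k x S hn v) z' c = 0 := by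
      intro z'
      apply Finset.sum_eq_zero
      intro u hu
      rw [hB_apply, hlow u hu]
      simp
    have h3 : ∀ z', d2 v z' c = 0 := by
      intro z'
      apply Finset.sum_eq_zero
      intro u hu
      rw [hlow u hu, mul_zero]
    obtain ⟨hm1, hm2⟩ := mn_spec hX.2.1 hS
    obtain ⟨hv1, hv2⟩ := vt_spec hn hX hS
    have hzm := (hX.2.2 _ hm1).1
    have hrs : ∀ z', z' ≤ mn c → insert (vt x S hn c) (sp x z') ⊆ sp x (mn c) := fun z' hz' =>
      Finset.insert_subset hv1 (sp_mono hz')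
    rw [dT_apply, if_pos hX, h2, add_zero]
    set a := vt x S hn c with ha
    by_cases haz : a ∈ sp x z
    · rw [hB_apply _ _ z c, if_neg (fun h => h.2.2 haz), sub_zero, sub_eq_zero, d1,
        Finset.sum_eq_single_of_mem a (Finset.mem_sdiff.2 ⟨haz, hv2⟩)]
      · rw [hB_apply, if_pos ⟨hx.Xp_er hX hv2, hS, by
          rw [hx.sp_er]; exact Finset.notMem_erase _ _⟩, ← ha, hx.sp_er, Finset.insert_erase haz,
          hx.eq_rs hzm]
        have e1 := neg_one_sq (k := k) c.card
        have e2 := eps_sq (k := k) (sp x z) a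
        linear_combination (-v z c) * e2 - (v z c * eps k (sp x z) a * eps k (sp x z) a) * e1
      · intro j hj hne
        rw [hB_apply, if_neg, mul_zero]
        intro h
        apply h.2.2
        rw [hx.sp_er]
        exact Finset.mem_erase.2 ⟨hne.symm, haz⟩
    · have hsub := hrs z hzm
      set y := rs x (mn c) (insert a (sp x z)) with hy
      have hspy : sp x y = insert a (sp x z) := hx.sp_rs hsub
      have hym : y ≤ mn c := hx.rs_le hsub
      have hXy : Xp x S y c := by
        refine ⟨?_, hX.2.1, fun u hu => ⟨hym.trans (hm2 u hu), (hX.2.2 u hu).2⟩⟩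
        rw [hspy]; exact hX.1.trans (Finset.subset_insert _ _)
      rw [hB_apply _ _ z c, if_pos ⟨hX, hS, haz⟩, ← ha, ← hy, dT_apply, if_pos hXy, h3, add_zero,
        d1, d1, hspy, Finset.insert_sdiff_of_notMem _ hv2,
        Finset.sum_insert (fun h => haz (Finset.mem_sdiff.1 h).1)]
      have hya : er x y a = z := by
        apply hx.eq_of ((hx.er_le _ _).trans hym) hzm
        rw [hx.sp_er, hspy, Finset.erase_insert haz]
      rw [hya]
      have h4 : ∑ j ∈ sp x z \ S, eps k (sp x z) j * hB k x S hn v (er x z j) c +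
          (-1) ^ c.card * (eps k (insert a (sp x z)) a *
          ∑ j ∈ sp x z \ S, eps k (insert a (sp x z)) j * v (er x y j) c) = 0 := by
        rw [Finset.mul_sum, Finset.mul_sum, ← Finset.sum_add_distrib]
        apply Finset.sum_eq_zero
        intro j hj
        obtain ⟨hjz, hjS⟩ := Finset.mem_sdiff.1 hj
        have hne : a ≠ j := fun h => haz (h ▸ hjz)
        have haej : a ∉ (sp x z).erase j := fun h => haz (Finset.mem_of_mem_erase h)
        have herm : er x z j ≤ mn c := (hx.er_le _ _).trans hzm
        rw [hB_apply, if_pos ⟨hx.Xp_er hX hjS, hS, by rw [hx.sp_er]; exact haej⟩, ← ha]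
        have e1 : rs x (mn c) (insert a (sp x (er x z j))) = er x y j := by
          apply hx.eq_of (hx.rs_le (hrs _ herm)) ((hx.er_le _ _).trans hym)
          rw [hx.sp_rs (hrs _ herm), hx.sp_er, hx.sp_er, hspy, Finset.erase_insert_of_ne hne]
        rw [e1, hx.sp_er, eps_insert haej, eps_erase hjz, eps_insert haz, eps_insert haz,
          if_neg (lt_irrefl a), if_neg (lt_irrefl a)]
        rcases lt_or_gt_of_ne hne with h | h
        · rw [if_pos h, if_neg h.not_gt]; ring
        · rw [if_pos h, if_neg h.not_gt]; ring
      have e1 := neg_one_sq (k := k) c.card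
      have e2 := eps_sq (k := k) (insert a (sp x z)) a
      linear_combination (-(-1) ^ c.card) * h4 - (v z c) * e2 -
        (v z c * eps k (insert a (sp x z)) a * eps k (insert a (sp x z)) a) * e1
end Total

section Cell
variable {P : Type} [Fintype P] [PartialOrder P] [OrderBot P] {n : ℕ} {k : Type} [Field k]
variable {x : Fin n → P} {S : Finset (Fin n)}

/-- The cellular complex. -/
def dC (k : Type) [Field k] (x : Fin n → P) (S : Finset (Fin n)) :
    (P → k) →ₗ[k] (P → k) where
  toFun g z := if S ⊆ sp x z then ∑ j ∈ sp x z \ S, eps k (sp x z) j * g (er x z j) else 0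
  map_add' g g' := by
    funext z
    simp only [Pi.add_apply]
    split_ifs
    · simp only [mul_add, Finset.sum_add_distrib]
    · simp
  map_smul' a g := by
    funext z
    simp only [Pi.smul_apply, smul_eq_mul, RingHom.id_apply]
    split_ifs
    · rw [Finset.mul_sum]
      exact Finset.sum_congr rfl fun j _ => by ring
    · simp

lemma dC_apply (g : P → k) (z : P) : dC k x S g z =
    if S ⊆ sp x z then ∑ j ∈ sp x z \ S, eps k (sp x z) j * g (er x z j) else 0 := rfl

/-- Graded pieces of the cellular complex. -/
def GC (k : Type) [Field k] (x : Fin n → P) (S : Finset (Fin n)) (t : ℤ) :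
    Submodule k (P → k) where
  carrier := {g | ∀ z, g z ≠ 0 → S ⊆ sp x z ∧ ((sp x z).card : ℤ) = t}
  add_mem' := by
    intro a b ha hb z h
    by_cases h1 : a z = 0
    · apply hb z
      intro h2
      simp [h1, h2] at h
    · exact ha z h1
  zero_mem' := by intro z h; simp at h
  smul_mem' := by
    intro r a ha z h
    apply ha z
    intro h2
    simp [h2] at h

/-- Restriction to empty chains. -/
def fC (P k : Type) [Field k] : (P → Finset P → k) →ₗ[k] (P → k) where
  toFun g z := g z ∅
  map_add' _ _ := rfl
  map_smul' _ _ := rfl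

lemma SPos.cellT (hx : SPos x) (t : ℤ) :
    Nonempty ((↥(LinearMap.ker (dT k x S) ⊓ GT k x S t) ⧸
        Submodule.comap (LinearMap.ker (dT k x S) ⊓ GT k x S t).subtype
          (Submodule.map (dT k x S) (GT k x S (t - 1)))) ≃ₗ[k]
      (↥(LinearMap.ker (dC k x S) ⊓ GC k x S t) ⧸
        Submodule.comap (LinearMap.ker (dC k x S) ⊓ GC k x S t).subtype
          (Submodule.map (dC k x S) (GC k x S (t - 1))))) := by
  apply qis (dT k x S) (dC k x S) (GT k x S) (GC k x S) (fC P k)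
  · intro t v hv z hz
    obtain ⟨h1, h2⟩ := hv z ∅ hz
    exact ⟨h1.1, by simpa using h2⟩
  · intro t w hw
    refine ⟨fun z c => if c = ∅ then w z else 0, ?_, ?_⟩
    · intro z c h
      dsimp only at h
      by_cases hc : c = ∅
      · subst hc
        rw [if_pos rfl] at h
        obtain ⟨h1, h2⟩ := hw z h
        exact ⟨⟨h1, by simp, by simp⟩, by simpa using h2⟩
      · rw [if_neg hc] at h; exact absurd rfl h
    · funext z
      change (if (∅ : Finset P) = ∅ then w z else 0) = w z
      exact if_pos rfl
  · intro t v hv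
    funext z
    change dT k x S v z ∅ = dC k x S (fC P k v) z
    rw [dT_apply, dC_apply]
    have : Xp x S z ∅ ↔ S ⊆ sp x z := ⟨fun h => h.1, fun h => ⟨h, by simp, by simp⟩⟩
    simp only [this]
    split_ifs
    · simp [d1, d2, fC]
    · rfl
  · exact hx.dT_GT
  · exact hx.dT_dT
  · intro t v hv hfv hdv
    by_cases hn : Nonempty (Fin n)
    · obtain ⟨u, hu, hu'⟩ := hx.acycB hn t v ⟨hv, fun z => congrFun hfv z⟩ hdv
      exact ⟨u, hu.1, funext hu.2, hu'⟩
    · rw [not_nonempty_iff] at hn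
      have hv0 : v = 0 := by
        funext z c
        by_contra h
        obtain ⟨h1, h2⟩ := hv z c h
        have hc : c = ∅ := by
          rw [Finset.eq_empty_iff_forall_notMem]
          intro u hu
          exact (h1.2.2 u hu).2 (Subsingleton.elim _ _)
        subst hc
        exact h (congrFun hfv z)
      exact ⟨0, Submodule.zero_mem _, map_zero _, by rw [hv0, map_zero]⟩

/-- Restriction to the links. -/
def fW (k : Type) [Field k] (p : P → Prop) : (P → Finset P → k) →ₗ[k]
    ((w : {w : P // p w}) → Finset (Set.Ici (w : P)) → k) where
  toFun g w s := g w (s.map (Function.Embedding.subtype _))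
  map_add' _ _ := rfl
  map_smul' _ _ := rfl

/-- The product of the link differentials. -/
def dW (k : Type) [Field k] (p : P → Prop) :
    ((w : {w : P // p w}) → Finset (Set.Ici (w : P)) → k) →ₗ[k]
    ((w : {w : P // p w}) → Finset (Set.Ici (w : P)) → k) :=
  LinearMap.pi fun w =>
    (cDelta k (Set.Ici (w : P)) (chainsK (Set.Ici (w : P)))).comp (LinearMap.proj w)

/-- The graded pieces of the product of the link complexes. -/
def GW (k : Type) [Field k] (p : P → Prop) (t : ℤ) :
    Submodule k ((w : {w : P // p w}) → Finset (Set.Ici (w : P)) → k) :=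
  Submodule.pi Set.univ fun w => cGraded k (Set.Ici (w : P)) (chainsK (Set.Ici (w : P))) t

lemma mem_cGraded {Q : Type} [Fintype Q] [PartialOrder Q] {K : Set (Finset Q)} {i : ℤ}
    {g : Finset Q → k} :
    g ∈ cGraded k Q K i ↔ ∀ s, g s ≠ 0 → s ∈ K ∧ (s.card : ℤ) = i + 1 := by
  unfold cGraded
  rw [Submodule.mem_pi]
  constructor
  · intro h s hs
    by_contra hc
    have := h s (Set.mem_univ s)
    rw [if_neg hc] at this
    exact hs this
  · intro h s _
    split_ifs with hc
    · trivial
    · by_contra h'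
      exact hc (h s h')

lemma SPos.link_iff (hx : SPos x) {w : P} (hw : sp x w = S) (s : Finset (Set.Ici w)) :
    s ∈ chainsK (Set.Ici w) ↔ Xp x S w (s.map (Function.Embedding.subtype _)) := by
  have hmin : ∀ q : Set.Ici w, IsMin q ↔ sp x q.1 = S := by
    intro q
    constructor
    · intro h
      have h1 : (⟨w, le_rfl⟩ : Set.Ici w) ≤ q := q.2
      have h2 := h h1
      have h3 : q.1 = w := le_antisymm h2 q.2
      rw [h3, hw]
    · intro h r _
      have h3 : w = q.1 := hx.eq_of q.2 le_rfl (hw.trans h.symm)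
      change q.1 ≤ r.1
      rw [← h3]; exact r.2
  constructor
  · rintro ⟨h1, h2⟩
    refine ⟨hw.ge, ?_, ?_⟩
    · intro a ha b hb hab
      simp only [Finset.coe_map, Set.mem_image] at ha hb
      obtain ⟨a, ha, rfl⟩ := ha
      obtain ⟨b, hb, rfl⟩ := hb
      exact h2 ha hb (fun h => hab (by rw [h]))
    · intro u hu
      obtain ⟨q, hq, rfl⟩ := Finset.mem_map.1 hu
      exact ⟨q.2, fun h => h1 q hq ((hmin q).2 h)⟩
  · rintro ⟨-, h1, h2⟩
    refine ⟨fun q hq h => (h2 q.1 (Finset.mem_map_of_mem _ hq)).2 ((hmin q).1 h), ?_⟩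
    intro a ha b hb hab
    exact h1 (Finset.mem_coe.2 (Finset.mem_map_of_mem (Function.Embedding.subtype _) ha))
      (Finset.mem_coe.2 (Finset.mem_map_of_mem (Function.Embedding.subtype _) hb))
      (fun h => hab (Subtype.ext h))

lemma SPos.linkT (hx : SPos x) (p : P → Prop) (hp : ∀ w, p w ↔ sp x w = S) (t : ℤ) :
    Nonempty ((↥(LinearMap.ker (dT k x S) ⊓ GT k x S t) ⧸
        Submodule.comap (LinearMap.ker (dT k x S) ⊓ GT k x S t).subtype
          (Submodule.map (dT k x S) (GT k x S (t - 1)))) ≃ₗ[k]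
      (↥(LinearMap.ker (dW k p) ⊓ GW k p (t - S.card - 1)) ⧸
        Submodule.comap (LinearMap.ker (dW k p) ⊓ GW k p (t - S.card - 1)).subtype
          (Submodule.map (dW k p) (GW k p ((t - 1) - S.card - 1))))) := by
  apply qis (dT k x S) (dW k p) (GT k x S) (fun t => GW k p (t - S.card - 1)) (fW k p)
  · intro t v hv w _
    refine mem_cGraded.2 ?_
    intro s hs
    obtain ⟨h1, h2⟩ := hv _ _ hs
    refine ⟨(hx.link_iff ((hp w).1 w.2) s).2 h1, ?_⟩
    rw [Finset.card_map, (hp w).1 w.2] at h2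
    omega
  · intro t u hu
    refine ⟨fun z c => if h : p z ∧ ∀ q ∈ c, z ≤ q then
      u ⟨z, h.1⟩ (c.subtype (· ∈ Set.Ici z)) else 0, ?_, ?_⟩
    · intro z c h
      dsimp only at h
      by_cases hc : p z ∧ ∀ q ∈ c, z ≤ q
      · rw [dif_pos hc] at h
        have h1 := mem_cGraded.1 (hu ⟨z, hc.1⟩ (Set.mem_univ _))
        obtain ⟨h2, h3⟩ := h1 _ h
        have h4 : (c.subtype (· ∈ Set.Ici z)).map (Function.Embedding.subtype _) = c :=
          Finset.subtype_map_of_mem hc.2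
        have hz := (hp z).1 hc.1
        rw [hx.link_iff hz] at h2
        rw [← Finset.card_map (Function.Embedding.subtype _)] at h3
        erw [h4] at h2 h3
        refine ⟨h2, ?_⟩
        rw [hz]
        omega
      · rw [dif_neg hc] at h; exact absurd rfl h
    · funext w s
      have hc : p w.1 ∧ ∀ q ∈ s.map (Function.Embedding.subtype _), w.1 ≤ q := by
        refine ⟨w.2, fun q hq => ?_⟩
        obtain ⟨q, hq, rfl⟩ := Finset.mem_map.1 hq
        exact q.2
      refine (dif_pos hc).trans ?_
      congr 1
      ext q
      simp only [Finset.mem_subtype, Finset.mem_map, Function.Embedding.subtype_apply]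
      exact ⟨fun ⟨a, ha, h⟩ => Subtype.ext h ▸ ha, fun h => ⟨q, h, rfl⟩⟩
  · intro t v hv
    funext w s
    change dT k x S v w (s.map (Function.Embedding.subtype _)) = cDelta k (Set.Ici (w : P))
      (chainsK (Set.Ici (w : P))) (fW k p v w) s
    rw [dT_apply]
    unfold cDelta
    rw [LinearMap.pi_apply]
    have hw := (hp w).1 w.2
    have hl := hx.link_iff hw s
    by_cases hX : s ∈ chainsK (Set.Ici (w : P))
    · rw [if_pos hX, if_pos (hl.1 hX)]
      have e1 : d1 x S v w (s.map (Function.Embedding.subtype _)) = 0 := by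
        rw [d1, hw]; simp
      rw [e1, mul_zero, zero_add, d2, Finset.sum_map, LinearMap.sum_apply]
      apply Finset.sum_congr rfl
      intro q hq
      rw [LinearMap.smul_apply, smul_eq_mul, LinearMap.proj_apply]
      have e2 : (s.map (Function.Embedding.subtype _)).erase q.1 =
          (s.erase q).map (Function.Embedding.subtype (· ∈ Set.Ici w.1)) := by
        rw [Finset.map_erase]; rfl
      have e3 : eps k (s.map (Function.Embedding.subtype _)) q.1 = eps k s q := by
        unfold eps
        rw [Finset.filter_map, Finset.card_map]
        rfl
      rw [eps_def]
      erw [e3, e2]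
      refine congrArg (eps k s q * ·) ?_
      change _ = v w _
      congr!
    · rw [if_neg hX, if_neg (fun h => hX (hl.2 h))]
      rfl
  · exact hx.dT_GT
  · exact hx.dT_dT
  · intro t v hv hfv hdv
    have : v ∈ GA k x S t := by
      refine ⟨hv, fun z c hz => ?_⟩
      by_contra h
      have hX := (hv z c h).1
      have h1 := congrFun (congrFun hfv ⟨z, (hp z).2 hz⟩) (c.subtype (· ∈ Set.Ici z))
      have h4 : (c.subtype (· ∈ Set.Ici z)).map (Function.Embedding.subtype _) = c :=
        Finset.subtype_map_of_mem (fun q hq => (hX.2.2 q hq).1)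
      change v z ((c.subtype (· ∈ Set.Ici z)).map (Function.Embedding.subtype _)) = 0 at h1
      rw [h4] at h1
      exact h h1
    obtain ⟨u, hu, hu'⟩ := hx.acycA t v this hdv
    refine ⟨u, hu.1, ?_, hu'⟩
    funext w s
    exact hu.2 _ _ ((hp w).1 w.2)

lemma linkW (p : P → Prop) (t : ℤ) :
    Nonempty ((↥(LinearMap.ker (dW k p) ⊓ GW k p t) ⧸
        Submodule.comap (LinearMap.ker (dW k p) ⊓ GW k p t).subtype
          (Submodule.map (dW k p) (GW k p (t - 1)))) ≃ₗ[k]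
      ((w : {w : P // p w}) → ReducedCoh k (Set.Ici (w : P)) t)) := by
  have h1 : LinearMap.ker (dW k p) ⊓ GW k p t = Submodule.pi Set.univ fun w : {w : P // p w} =>
      ZC k (Set.Ici (w : P)) (chainsK (Set.Ici (w : P))) t := by
    ext v
    constructor
    · rintro ⟨h1, h2⟩ w hw
      exact ⟨congrFun (LinearMap.mem_ker.1 h1) w, h2 w hw⟩
    · intro h
      exact ⟨LinearMap.mem_ker.2 (funext fun w => (h w (Set.mem_univ w)).1),
        fun w hw => (h w hw).2⟩
  have h2 : Submodule.map (dW k p) (GW k p (t - 1)) =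
      Submodule.pi Set.univ fun w : {w : P // p w} =>
      BC k (Set.Ici (w : P)) (chainsK (Set.Ici (w : P))) t := by
    ext v
    constructor
    · rintro ⟨u, hu, rfl⟩ w hw
      exact ⟨u w, hu w hw, rfl⟩
    · intro h
      choose u hu hu' using fun w => h w (Set.mem_univ w)
      exact ⟨u, fun w _ => hu w, funext hu'⟩
  rw [h1, h2]
  exact quot_pi _ _

lemma SPos.cellLink (hx : SPos x) (p : P → Prop) (hp : ∀ w, p w ↔ sp x w = S) (t : ℤ) :
    Nonempty ((↥(LinearMap.ker (dC k x S) ⊓ GC k x S t) ⧸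
        Submodule.comap (LinearMap.ker (dC k x S) ⊓ GC k x S t).subtype
          (Submodule.map (dC k x S) (GC k x S (t - 1)))) ≃ₗ[k]
      ((w : {w : P // p w}) → ReducedCoh k (Set.Ici (w : P)) (t - S.card - 1))) := by
  obtain ⟨e1⟩ := hx.cellT (k := k) (S := S) t
  obtain ⟨e2⟩ := hx.linkT (k := k) (S := S) p hp t
  obtain ⟨e3⟩ := linkW (k := k) p (t - S.card - 1)
  rw [show t - 1 - (S.card : ℤ) - 1 = t - S.card - 1 - 1 by ring] at e2
  exact ⟨(e1.symm.trans e2).trans e3⟩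
end Cell

section Koszul
variable {P : Type} [Fintype P] [PartialOrder P] [OrderBot P] {n : ℕ} {k : Type} [Field k]
variable {x : Fin n → P} {α : Fin n → ℤ} {ℓ t : ℕ}

/-- The degree of the component at `G`. -/
def bt (α : Fin n → ℤ) (ℓ : ℕ) (G : Finset (Fin n)) : Fin n → ℤ :=
  fun j => α j + if j ∈ G then (ℓ : ℤ) else 0

/-- Homogeneous cochains. -/
def PK (k : Type) [Field k] (x : Fin n → P) (α : Fin n → ℤ) (ℓ : ℕ) (f : KCochain P k n) : Prop :=
  ∀ G, f G ∈ facePiece P k n x (bt α ℓ G)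

lemma mem_gradedKC {f : KCochain P k n} : f ∈ gradedKC P k n x ℓ t α ↔
    PK k x α ℓ f ∧ ∀ G, G.card ≠ t → f G = 0 := by
  unfold gradedKC
  rw [Submodule.mem_pi]
  constructor
  · intro h
    refine ⟨fun G => ?_, fun G hG => ?_⟩
    · have := h G (Set.mem_univ G)
      split_ifs at this with hc
      · exact this
      · rw [(Submodule.mem_bot k).1 this]; exact Submodule.zero_mem _
    · have := h G (Set.mem_univ G)
      rw [if_neg hG] at this
      exact this
  · intro h G _
    split_ifs with hc
    · exact h.1 G
    · exact h.2 G hc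

lemma koszulD_apply (f : KCochain P k n) (G : Finset (Fin n)) :
    koszulD P k n x ℓ f G = ∑ j ∈ G, eps k G j • (fv P k (x j) ^ ℓ * f (G.erase j)) := by
  unfold koszulD
  rw [LinearMap.pi_apply, LinearMap.sum_apply]
  apply Finset.sum_congr rfl
  intro j _
  rw [← eps_def]
  rfl

lemma transKC_apply (f : KCochain P k n) (G : Finset (Fin n)) :
    transKC P k n x f G = (∏ j ∈ G, fv P k (x j)) * f G := rfl

lemma SPos.xmul (hx : SPos x) {G : Finset (Fin n)} {j : Fin n} (hj : j ∈ G) {r : FaceRing P k}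
    (hr : r ∈ facePiece P k n x (bt α ℓ (G.erase j))) :
    fv P k (x j) ^ ℓ * r ∈ facePiece P k n x (bt α ℓ G) := by
  have := facePiece_mul (pow_facePiece (hx.x_facePiece (k := k) j) ℓ) hr
  convert this using 2
  funext i
  by_cases hij : i = j
  · subst hij; simp [bt, hj]; ring
  · simp [bt, hij]

lemma SPos.D_PK (hx : SPos x) {f : KCochain P k n} (hf : PK k x α ℓ f) :
    PK k x α ℓ (koszulD P k n x ℓ f) := by
  intro G
  rw [koszulD_apply]
  apply Submodule.sum_mem
  intro j hj
  exact Submodule.smul_mem _ _ (hx.xmul hj (hf _))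

lemma SPos.D_graded (hx : SPos x) {f : KCochain P k n} (hf : f ∈ gradedKC P k n x ℓ t α) :
    koszulD P k n x ℓ f ∈ gradedKC P k n x ℓ (t + 1) α := by
  rw [mem_gradedKC] at *
  refine ⟨hx.D_PK hf.1, fun G hG => ?_⟩
  rw [koszulD_apply]
  apply Finset.sum_eq_zero
  intro j hj
  rw [hf.2, mul_zero, smul_zero]
  rw [Finset.card_erase_of_mem hj]
  have := Finset.card_pos.2 ⟨j, hj⟩
  omega

lemma SPos.T_PK (hx : SPos x) {f : KCochain P k n} (hf : PK k x α ℓ f) :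
    PK k x α (ℓ + 1) (transKC P k n x f) := by
  intro G
  rw [transKC_apply]
  have := facePiece_mul (prod_facePiece G (fun j => fv P k (x j)) _
    (fun j _ => hx.x_facePiece (k := k) j)) (hf G)
  convert this using 2
  funext i
  rw [Pi.add_apply, Finset.sum_apply]
  simp only [Pi.single_apply, Finset.sum_ite_eq, bt]
  split_ifs <;> push_cast <;> ring

lemma SPos.T_graded (hx : SPos x) {f : KCochain P k n} (hf : f ∈ gradedKC P k n x ℓ t α) :
    transKC P k n x f ∈ gradedKC P k n x (ℓ + 1) t α := by
  rw [mem_gradedKC] at *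
  refine ⟨hx.T_PK hf.1, fun G hG => ?_⟩
  rw [transKC_apply, hf.2 G hG, mul_zero]

lemma T_D (f : KCochain P k n) : transKC P k n x (koszulD P k n x ℓ f) =
    koszulD P k n x (ℓ + 1) (transKC P k n x f) := by
  funext G
  rw [transKC_apply, koszulD_apply, koszulD_apply, Finset.mul_sum]
  apply Finset.sum_congr rfl
  intro j hj
  rw [transKC_apply, ← Finset.mul_prod_erase G _ hj, mul_smul_comm]
  congr 1
  ring

lemma SPos.ext_all (hx : SPos x) {β : Fin n → ℤ} {r : FaceRing P k}
    (hr : r ∈ facePiece P k n x β) (h : ∀ z, (∀ j, j ∈ sp x z ↔ β j ≠ 0) → hx.ev k z r = 0) :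
    r = 0 := by
  by_cases hβ : ∃ j, β j < 0
  · obtain ⟨j, hj⟩ := hβ
    rw [facePiece_neg hj] at hr
    exact hr
  · push Not at hβ
    have e : β = fun j => (((β j).toNat : ℕ) : ℤ) := by
      funext j; have := hβ j; omega
    rw [e] at hr
    refine hx.ext_ev hr (Submodule.zero_mem _) ?_
    intro z hz
    rw [map_zero]
    apply h
    intro j
    rw [hz, mem_spb]
    have := hβ j
    omega

lemma SPos.D_D (hx : SPos x) {f : KCochain P k n} (hf : PK k x α ℓ f) :
    koszulD P k n x ℓ (koszulD P k n x ℓ f) = 0 := by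
  funext G
  apply hx.ext_all (hx.D_PK (hx.D_PK hf) G)
  intro z _
  rw [koszulD_apply, map_sum]
  rw [← eps_dd (k := k) (A := G) (T := G) (Finset.Subset.refl G)
    (fun i _ j _ hij => lt_or_gt_of_ne hij)
    (fun i j => hx.ev k z (fv P k (x i)) ^ ℓ * hx.ev k z (fv P k (x j)) ^ ℓ *
      hx.ev k z (f ((G.erase i).erase j)))
    (fun i j => by rw [Finset.erase_right_comm]; ring)]
  apply Finset.sum_congr rfl
  intro j hj
  rw [map_smul, smul_eq_mul, map_mul, koszulD_apply, map_sum, Finset.mul_sum, map_pow]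
  congr 1
  apply Finset.sum_congr rfl
  intro i hi
  rw [map_smul, smul_eq_mul, map_mul, map_pow]
  ring

/-! Vanishing -/

lemma SPos.xinj (hx : SPos x) {G : Finset (Fin n)} {j : Fin n} (hα : 0 < α j) {r : FaceRing P k}
    (hr : r ∈ facePiece P k n x (bt α ℓ G)) (h : fv P k (x j) ^ ℓ * r = 0) : r = 0 := by
  apply hx.ext_all hr
  intro z hz
  have h1 := congrArg (hx.ev k z) h
  have hj : j ∈ sp x z := by
    rw [hz, bt]
    split_ifs <;> omega
  rwa [map_mul, map_pow, hx.ev_x, if_pos hj, one_pow, one_mul, map_zero] at h1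

lemma SPos.xsurj (hx : SPos x) {G : Finset (Fin n)} {j : Fin n} (hj : j ∈ G) (hα : 0 < α j)
    {s : FaceRing P k} (hs : s ∈ facePiece P k n x (bt α ℓ G)) :
    ∃ r ∈ facePiece P k n x (bt α ℓ (G.erase j)), fv P k (x j) ^ ℓ * r = s := by
  by_cases hβ : ∃ i, bt α ℓ (G.erase j) i < 0
  · obtain ⟨i, hi⟩ := hβ
    refine ⟨0, Submodule.zero_mem _, ?_⟩
    have : bt α ℓ G i < 0 := by
      by_cases hij : i = j
      · subst hij; simp [bt] at hi; omega
      · simpa [bt, hij] using hi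
    rw [facePiece_neg this] at hs
    rw [mul_zero, (Submodule.mem_bot k).1 hs]
  · push Not at hβ
    have e : bt α ℓ (G.erase j) = fun i => (((bt α ℓ (G.erase j) i).toNat : ℕ) : ℤ) := by
      funext i; have := hβ i; omega
    obtain ⟨r, hr, hr'⟩ := hx.exists_ev (k := k) (fun i => (bt α ℓ (G.erase j) i).toNat)
      (fun z => hx.ev k z s)
    rw [← e] at hr
    refine ⟨r, hr, ?_⟩
    rw [← sub_eq_zero]
    apply hx.ext_all (Submodule.sub_mem _ (hx.xmul hj hr) hs)
    intro z hz
    have hjz : j ∈ sp x z := by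
      rw [hz, bt]
      split_ifs <;> omega
    rw [map_sub, map_mul, map_pow, hx.ev_x, if_pos hjz, one_pow, one_mul, hr' z, sub_self]
    ext i
    rw [hz, mem_spb]
    have h1 := hβ i
    by_cases hij : i = j
    · subst hij
      simp [bt, hj] at h1 ⊢; omega
    · simp [bt, hij] at h1 ⊢; omega

lemma SPos.ext_vanish (hx : SPos x) {j : Fin n} (hα : 0 < α j) :
    Subsingleton (ExtPiece P k n x ℓ t α) := by
  have H : ∀ f ∈ ZK P k n x ℓ t α, f ∈ BK P k n x ℓ t α := by
    rintro f ⟨hD, hf⟩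
    rw [SetLike.mem_coe, LinearMap.mem_ker] at hD
    have hf' := mem_gradedKC.1 hf
    have hex : ∀ G : Finset (Fin n), ∃ r, j ∉ G → r ∈ facePiece P k n x (bt α ℓ G) ∧
        fv P k (x j) ^ ℓ * r = f (insert j G) := by
      intro G
      by_cases hj : j ∈ G
      · exact ⟨0, fun h => absurd hj h⟩
      · obtain ⟨r, hr, hr'⟩ := hx.xsurj (Finset.mem_insert_self j G) hα (hf'.1 (insert j G))
        rw [Finset.erase_insert hj] at hr
        exact ⟨r, fun _ => ⟨hr, hr'⟩⟩
    choose r hr using hex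
    let y : KCochain P k n := fun G =>
      if j ∉ G ∧ G.card + 1 = t then eps k (insert j G) j • r G else 0
    have hy : y ∈ gradedKC P k n x ℓ (t - 1) α := by
      rw [mem_gradedKC]
      constructor
      · intro G
        change (if j ∉ G ∧ G.card + 1 = t then eps k (insert j G) j • r G else 0) ∈ _
        split_ifs with h
        · exact Submodule.smul_mem _ _ (hr G h.1).1
        · exact Submodule.zero_mem _
      · intro G hG
        exact if_neg (fun h => hG (by omega))
    have hy' := mem_gradedKC.1 hy
    refine ⟨y, hy, ?_⟩
    have e1 : ∀ G, j ∈ G → koszulD P k n x ℓ y G = f G := by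
      intro G hj
      rw [koszulD_apply, Finset.sum_eq_single_of_mem j hj]
      · change eps k G j • (fv P k (x j) ^ ℓ * (if j ∉ G.erase j ∧ (G.erase j).card + 1 = t then
          eps k (insert j (G.erase j)) j • r (G.erase j) else 0)) = f G
        rw [Finset.insert_erase hj, Finset.card_erase_add_one hj]
        have := (hr (G.erase j) (Finset.notMem_erase j G)).2
        rw [Finset.insert_erase hj] at this
        by_cases hc : G.card = t
        · rw [if_pos ⟨Finset.notMem_erase j G, hc⟩, mul_smul_comm, smul_smul, eps_sq, one_smul, this]
        · rw [if_neg (fun h => hc h.2), mul_zero, smul_zero, hf'.2 G hc]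
      · intro i hi hij
        have : y (G.erase i) = 0 :=
          if_neg (fun h => h.1 (Finset.mem_erase.2 ⟨hij.symm, hj⟩))
        rw [this, mul_zero, smul_zero]
    have e2 := hx.D_D hy'.1
    have e3 : koszulD P k n x ℓ (koszulD P k n x ℓ y - f) = 0 := by
      rw [map_sub, e2, hD, sub_zero]
    funext G
    by_cases hj : j ∈ G
    · exact e1 G hj
    · rw [← sub_eq_zero]
      have e4 := congrFun e3 (insert j G)
      rw [koszulD_apply, Finset.sum_eq_single_of_mem j (Finset.mem_insert_self j G),
        Finset.erase_insert hj] at e4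
      · have e5 := congrArg (eps k (insert j G) j • ·) e4
        simp only [smul_smul, eps_sq, one_smul, Pi.zero_apply, smul_zero] at e5
        exact hx.xinj hα (Submodule.sub_mem _ (hx.D_PK hy'.1 G) (hf'.1 G)) e5
      · intro i _ hij
        rw [Pi.sub_apply, e1 _ (Finset.mem_erase.2 ⟨hij.symm, Finset.mem_insert_self j G⟩),
          sub_self, mul_zero, smul_zero]
  have H' : ∀ q : ExtPiece P k n x ℓ t α, q = 0 := by
    intro q
    obtain ⟨v, rfl⟩ := Submodule.Quotient.mk_surjective _ q
    rw [Submodule.Quotient.mk_eq_zero]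
    exact H v.1 v.2
  exact ⟨fun a b => (H' a).trans (H' b).symm⟩

/-! The nonpositive case -/

/-- Evaluation of cochains on cells. -/
def SPos.psi (hx : SPos x) (k : Type) [Field k] : KCochain P k n →ₗ[k] (P → k) where
  toFun f z := hx.ev k z (f (sp x z))
  map_add' f g := by funext z; simp
  map_smul' a f := by funext z; simp

lemma SPos.psi_apply (hx : SPos x) (f : KCochain P k n) (z : P) :
    hx.psi k f z = hx.ev k z (f (sp x z)) := rfl

variable {S : Finset (Fin n)}

lemma PK.zero {f : KCochain P k n} (hf : PK k x α ℓ f) (hS : ∀ j, j ∈ S ↔ α j ≠ 0)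
    (h0 : ∀ j, α j ≤ 0) {G : Finset (Fin n)} (hG : ¬ S ⊆ G) : f G = 0 := by
  rw [Finset.not_subset] at hG
  obtain ⟨j, hj, hjG⟩ := hG
  have h1 := hf G
  rw [facePiece_neg (j := j)] at h1
  · exact h1
  · rw [hS] at hj
    have := h0 j
    rw [bt, if_neg hjG]
    omega

lemma bt_supp (hS : ∀ j, j ∈ S ↔ α j ≠ 0) (h0 : ∀ j, α j ≤ 0) (hl : ∀ j, - α j < ℓ)
    {G : Finset (Fin n)} (hG : S ⊆ G) (j : Fin n) : 0 ≤ bt α ℓ G j ∧ (bt α ℓ G j ≠ 0 ↔ j ∈ G) := by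
  have h1 := hS j
  have h2 := h0 j
  have h3 := hl j
  have h4 := @hG j
  unfold bt
  by_cases hj : j ∈ G
  · simp only [hj, if_true, iff_true]; omega
  · have h5 : α j = 0 := by
      by_contra h
      exact hj (h4 (h1.2 h))
    simp [hj, h5]

lemma SPos.psi_inj (hx : SPos x) (hS : ∀ j, j ∈ S ↔ α j ≠ 0) (h0 : ∀ j, α j ≤ 0)
    (hl : ∀ j, - α j < ℓ) {f g : KCochain P k n} (hf : PK k x α ℓ f) (hg : PK k x α ℓ g)
    (h : hx.psi k f = hx.psi k g) : f = g := by
  funext G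
  by_cases hG : S ⊆ G
  · rw [← sub_eq_zero]
    apply hx.ext_all (Submodule.sub_mem _ (hf G) (hg G))
    intro z hz
    have : sp x z = G := by
      ext j
      rw [hz, (bt_supp hS h0 hl hG j).2]
    rw [map_sub, ← this]
    exact sub_eq_zero.2 (congrFun h z)
  · rw [hf.zero hS h0 hG, hg.zero hS h0 hG]

lemma SPos.psi_surj (hx : SPos x) (hS : ∀ j, j ∈ S ↔ α j ≠ 0) (h0 : ∀ j, α j ≤ 0)
    (hl : ∀ j, - α j < ℓ) {g : P → k} (hg : g ∈ GC k x S t) :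
    ∃ f ∈ gradedKC P k n x ℓ t α, hx.psi k f = g := by
  have hex : ∀ G : Finset (Fin n), ∃ r ∈ facePiece P k n x (bt α ℓ G),
      (G.card ≠ t → r = 0) ∧ ∀ z, sp x z = G → hx.ev k z r = g z := by
    intro G
    by_cases hG : S ⊆ G ∧ G.card = t
    · have e : bt α ℓ G = fun i => (((bt α ℓ G i).toNat : ℕ) : ℤ) := by
        funext i; have := (bt_supp hS h0 hl hG.1 i).1; omega
      obtain ⟨r, hr, hr'⟩ := hx.exists_ev (k := k) (fun i => (bt α ℓ G i).toNat) g
      rw [← e] at hr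
      refine ⟨r, hr, fun h => absurd hG.2 h, fun z hz => hr' z ?_⟩
      ext i
      have := bt_supp hS h0 hl hG.1 i
      rw [hz, mem_spb, ← this.2]
      omega
    · refine ⟨0, Submodule.zero_mem _, fun _ => rfl, fun z hz => ?_⟩
      rw [map_zero]
      by_contra h
      have := hg z (Ne.symm h)
      rw [hz] at this
      exact hG ⟨this.1, by exact_mod_cast this.2⟩
  choose f hf hf1 hf2 using hex
  exact ⟨f, mem_gradedKC.2 ⟨hf, hf1⟩, funext fun z => hf2 _ z rfl⟩

lemma SPos.psi_GC (hx : SPos x) (hS : ∀ j, j ∈ S ↔ α j ≠ 0) (h0 : ∀ j, α j ≤ 0)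
    {f : KCochain P k n} (hf : f ∈ gradedKC P k n x ℓ t α) : hx.psi k f ∈ GC k x S t := by
  rw [mem_gradedKC] at hf
  intro z hz
  rw [hx.psi_apply] at hz
  constructor
  · by_contra h
    rw [hf.1.zero hS h0 h, map_zero] at hz
    exact hz rfl
  · by_contra h
    rw [hf.2 _ (fun h' => h (by rw [h'])), map_zero] at hz
    exact hz rfl

lemma SPos.psi_D (hx : SPos x) (hS : ∀ j, j ∈ S ↔ α j ≠ 0) (h0 : ∀ j, α j ≤ 0)
    (hl : ∀ j, - α j < ℓ) {f : KCochain P k n} (hf : PK k x α ℓ f) :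
    hx.psi k (koszulD P k n x ℓ f) = dC k x S (hx.psi k f) := by
  funext z
  rw [hx.psi_apply, koszulD_apply, map_sum, dC_apply]
  have e : ∀ j ∈ sp x z, hx.ev k z (eps k (sp x z) j • (fv P k (x j) ^ ℓ * f ((sp x z).erase j))) =
      eps k (sp x z) j * hx.ev k z (f ((sp x z).erase j)) := by
    intro j hj
    rw [map_smul, smul_eq_mul, map_mul, map_pow, hx.ev_x, if_pos hj, one_pow, one_mul]
  rw [Finset.sum_congr rfl e]
  split_ifs with hz
  · symm
    rw [← Finset.sum_subset (Finset.sdiff_subset (s := sp x z) (t := S))]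
    · apply Finset.sum_congr rfl
      intro j hj
      have hjS := (Finset.mem_sdiff.1 hj).2
      rw [hx.psi_apply, hx.sp_er]
      congr 1
      have hG : S ⊆ (sp x z).erase j := Finset.subset_erase.2 ⟨hz, hjS⟩
      have e : bt α ℓ ((sp x z).erase j) =
          fun i => (((bt α ℓ ((sp x z).erase j) i).toNat : ℕ) : ℤ) := by
        funext i; have := (bt_supp hS h0 hl hG i).1; omega
      have h1 := hf ((sp x z).erase j)
      rw [e] at h1
      refine hx.ev_mono (hx.er_le z j) ?_ h1
      intro i hi
      have := bt_supp hS h0 hl hG i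
      rw [hx.sp_er, ← this.2]
      rw [mem_spb] at hi
      omega
    · intro j hj hj'
      have : j ∈ S := by
        by_contra h
        exact hj' (Finset.mem_sdiff.2 ⟨hj, h⟩)
      rw [hf.zero hS h0 (fun h => Finset.notMem_erase j _ (h this)), map_zero, mul_zero]
  · apply Finset.sum_eq_zero
    intro j hj
    rw [hf.zero hS h0 (fun h => hz (h.trans (Finset.erase_subset _ _))), map_zero, mul_zero]

lemma SPos.psi_T (hx : SPos x) (f : KCochain P k n) : hx.psi k (transKC P k n x f) = hx.psi k f := by
  funext z
  rw [hx.psi_apply, hx.psi_apply, transKC_apply, map_mul, map_prod, Finset.prod_eq_one, one_mul]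
  intro j hj
  rw [hx.ev_x, if_pos hj]

lemma SPos.extCell (hx : SPos x) (hS : ∀ j, j ∈ S ↔ α j ≠ 0) (h0 : ∀ j, α j ≤ 0)
    (hl : ∀ j, - α j < ℓ) :
    Nonempty (ExtPiece P k n x ℓ t α ≃ₗ[k]
      (↥(LinearMap.ker (dC k x S) ⊓ GC k x S (t : ℤ)) ⧸
        Submodule.comap (LinearMap.ker (dC k x S) ⊓ GC k x S (t : ℤ)).subtype
          (Submodule.map (dC k x S) (GC k x S ((t : ℤ) - 1))))) := by
  apply quot_equiv _ _ _ _ (hx.psi k)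
  · rintro v ⟨hD, hv⟩
    rw [SetLike.mem_coe, LinearMap.mem_ker] at hD
    refine ⟨?_, hx.psi_GC hS h0 hv⟩
    rw [SetLike.mem_coe, LinearMap.mem_ker, ← hx.psi_D hS h0 hl (mem_gradedKC.1 hv).1, hD, map_zero]
  · rintro v ⟨hD, hv⟩
    have hv' := mem_gradedKC.1 hv
    have hz : PK k x α ℓ (0 : KCochain P k n) := fun G => Submodule.zero_mem _
    cases t with
    | zero =>
      constructor
      · rintro ⟨g, hg, hgv⟩
        have hg0 : g = 0 := by
          funext z
          by_contra h
          have := (hg z h).2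
          simp at this
        rw [hg0, map_zero] at hgv
        have : v = 0 := hx.psi_inj hS h0 hl hv'.1 hz (by rw [← hgv, map_zero])
        rw [this]; exact Submodule.zero_mem _
      · rintro ⟨f, hf, rfl⟩
        have : koszulD P k n x ℓ f = 0 := by
          funext G
          by_cases hG : G.card = 0
          · rw [Finset.card_eq_zero] at hG
            rw [hG, koszulD_apply, Finset.sum_empty]; rfl
          · exact hv'.2 G hG
        rw [this, map_zero]; exact Submodule.zero_mem _
    | succ s =>
      have hs : ((s + 1 : ℕ) : ℤ) - 1 = (s : ℤ) := by push_cast; ring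
      rw [hs]
      constructor
      · rintro ⟨g, hg, hgv⟩
        obtain ⟨f, hf, rfl⟩ := hx.psi_surj hS h0 hl hg
        have hf' := (mem_gradedKC.1 hf).1
        rw [← hx.psi_D hS h0 hl hf'] at hgv
        exact ⟨f, hf, hx.psi_inj hS h0 hl (hx.D_PK hf') hv'.1 hgv⟩
      · rintro ⟨f, hf, rfl⟩
        exact ⟨hx.psi k f, hx.psi_GC hS h0 hf, (hx.psi_D hS h0 hl (mem_gradedKC.1 hf).1).symm⟩
  · rintro y ⟨hD, hy⟩
    rw [SetLike.mem_coe, LinearMap.mem_ker] at hD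
    obtain ⟨f, hf, rfl⟩ := hx.psi_surj hS h0 hl hy
    have hf' := (mem_gradedKC.1 hf).1
    refine ⟨f, ⟨?_, hf⟩, by rw [sub_self]; exact Submodule.zero_mem _⟩
    rw [SetLike.mem_coe, LinearMap.mem_ker]
    refine hx.psi_inj hS h0 hl (hx.D_PK hf') (fun G => Submodule.zero_mem _) ?_
    rw [hx.psi_D hS h0 hl hf', hD, map_zero]

lemma SPos.transExt_bij (hx : SPos x) (hS : ∀ j, j ∈ S ↔ α j ≠ 0) (h0 : ∀ j, α j ≤ 0)
    (hl : ∀ j, - α j < ℓ) : Function.Bijective (transExt P k n x ℓ t α) := by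
  have hl' : ∀ j, - α j < (ℓ + 1 : ℕ) := fun j => by have := hl j; push_cast; omega
  have hTinj : ∀ f g : KCochain P k n, PK k x α ℓ f → PK k x α ℓ g →
      transKC P k n x f = transKC P k n x g → f = g := by
    intro f g hf hg h
    apply hx.psi_inj hS h0 hl hf hg
    rw [← hx.psi_T, h, hx.psi_T]
  have hTsurj : ∀ s, ∀ y ∈ gradedKC P k n x (ℓ + 1) s α, ∃ f ∈ gradedKC P k n x ℓ s α,
      transKC P k n x f = y := by
    intro s y hy
    obtain ⟨f, hf, h⟩ := hx.psi_surj hS h0 hl (hx.psi_GC hS h0 hy)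
    refine ⟨f, hf, hx.psi_inj hS h0 hl' (hx.T_PK (mem_gradedKC.1 hf).1) (mem_gradedKC.1 hy).1 ?_⟩
    rw [hx.psi_T, h]
  have hZ : ∀ v ∈ ZK P k n x ℓ t α, transKC P k n x v ∈ ZK P k n x (ℓ + 1) t α := by
    rintro v ⟨hD, hv⟩
    rw [SetLike.mem_coe, LinearMap.mem_ker] at hD
    refine ⟨?_, hx.T_graded hv⟩
    rw [SetLike.mem_coe, LinearMap.mem_ker, ← T_D, hD, map_zero]
  have h : ∃ g : ↥(ZK P k n x ℓ t α) →ₗ[k] ↥(ZK P k n x (ℓ + 1) t α),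
      (∀ v : ↥(ZK P k n x ℓ t α),
        (g v : KCochain P k n) = transKC P k n x (v : KCochain P k n)) ∧
      Submodule.comap (ZK P k n x ℓ t α).subtype (BK P k n x ℓ t α) ≤
        (Submodule.comap (ZK P k n x (ℓ + 1) t α).subtype
          (BK P k n x (ℓ + 1) t α)).comap g := by
    refine ⟨(transKC P k n x).restrict hZ, fun v => rfl, ?_⟩
    rintro v ⟨f, hf, hfv⟩
    refine ⟨transKC P k n x f, hx.T_graded hf, ?_⟩
    rw [← T_D, hfv]
    rfl
  unfold transExt
  rw [dif_pos h]
  have hg := h.choose_spec.1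
  apply quot_bij
  · intro v hv
    rw [hg] at hv
    obtain ⟨u, hu, huv⟩ := hv
    obtain ⟨f, hf, rfl⟩ := hTsurj _ u hu
    rw [← T_D] at huv
    exact ⟨f, hf, hTinj _ _ (hx.D_PK (mem_gradedKC.1 hf).1) (mem_gradedKC.1 v.2.2).1 huv⟩
  · intro y
    obtain ⟨f, hf, hfy⟩ := hTsurj _ y.1 y.2.2
    have hf' := (mem_gradedKC.1 hf).1
    have hfZ : f ∈ ZK P k n x ℓ t α := by
      refine ⟨?_, hf⟩
      rw [SetLike.mem_coe, LinearMap.mem_ker]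
      refine hTinj _ _ (hx.D_PK hf') (fun G => Submodule.zero_mem _) ?_
      rw [T_D, hfy, map_zero]
      exact LinearMap.mem_ker.1 y.2.1
    refine ⟨⟨f, hfZ⟩, ?_⟩
    rw [hg, hfy, sub_self]
    exact Submodule.zero_mem _

end Koszul

end HL

/-- Theorem 4.2 (Duval/Hochster-type formula): for `α ∈ ℤⁿ` with a positive entry the
graded piece `H_m^t(A_P)_α` of local cohomology vanishes, and for `α ∈ ℤ_{≤0}ⁿ`,
`H_m^t(A_P)_α ≅ ⊕_{supp(w) = supp(α)} H̃^{t - |supp α| - 1}(lk_P w)`. -/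
theorem localCohomology_hochster
    (hP : IsSimplicialPoset P)
    (hinj : Function.Injective x) (hatom : ∀ i, IsAtom (x i))
    (hsurj : ∀ a : P, IsAtom a → ∃ i, x i = a)
    (t : ℕ) (α : Fin n → ℤ) :
    ((∃ j, 0 < α j) → Subsingleton (LocCoh P k n x t α)) ∧
    ((∀ i, α i ≤ 0) → Nonempty (LocCoh P k n x t α ≃ₗ[k]
      ((w : {w : P // ∀ i : Fin n, x i ≤ w ↔ α i ≠ 0}) →
        ReducedCoh k (Set.Ici (w : P))
          ((t : ℤ) - (Finset.univ.filter fun i : Fin n => α i ≠ 0).card - 1)))) := by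
  have hx : HL.SPos x := ⟨hP, hinj, hatom, hsurj⟩
  refine ⟨fun ⟨j, hj⟩ => HL.locCoh_sub 0 fun ℓ _ => hx.ext_vanish hj, fun h0 => ?_⟩
  have hS : ∀ j, j ∈ (Finset.univ.filter fun i : Fin n => α i ≠ 0) ↔ α j ≠ 0 := by simp
  have hb : ∃ ℓ₀ : ℕ, ∀ j, - α j < ℓ₀ := by
    refine ⟨(∑ j, (- α j).toNat) + 1, fun j => ?_⟩
    have h1 := Finset.single_le_sum (f := fun j => (- α j).toNat) (fun _ _ => Nat.zero_le _)
      (Finset.mem_univ j)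
    have h2 := Int.self_le_toNat (- α j)
    omega
  obtain ⟨ℓ₀, hl⟩ := hb
  obtain ⟨e1⟩ := HL.locCoh_equiv (P := P) (k := k) (n := n) (x := x) (t := t) (α := α) ℓ₀
    (fun ℓ hℓ => hx.transExt_bij hS h0 (fun j => lt_of_lt_of_le (hl j) (by exact_mod_cast hℓ)))
  obtain ⟨e2⟩ := hx.extCell (k := k) (t := t) hS h0 hl
  obtain ⟨e3⟩ := hx.cellLink (k := k) (S := Finset.univ.filter fun i : Fin n => α i ≠ 0)
    (fun w => ∀ i : Fin n, x i ≤ w ↔ α i ≠ 0) (fun w => by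
      rw [Finset.ext_iff]
      simp only [HL.mem_sp, hS]) (t : ℤ)
  exact ⟨(e1.trans e2).trans e3⟩

end
end

section
/- Let P be a simplicial poset and α ∈ ℤⁿ with 1 − ℓ ≤ αᵢ for all i. Then the canonical map Ext_A^i(A/m_ℓ, A_P)_α → H_m^i(A_P)_α (from the direct limit defining local cohomology) is an isomorphism for all i. -/
open scoped Classical
open MvPolynomial

noncomputable section

variable (P : Type) [Fintype P] [PartialOrder P] [OrderBot P]
variable (k : Type) [Field k]

variable (n : ℕ) (x : Fin n → P)

section Helpers

set_option linter.unusedSectionVars false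

/-- The set of (indices of) atoms below a face. -/
def fsupp (y : P) : Finset (Fin n) := Finset.univ.filter fun i => x i ≤ y

/-- The combinatorial consequences of being a simplicial poset which are used below. -/
structure GoodPoset : Prop where
  le_of : ∀ z y y' : P, y ≤ z → y' ≤ z → (∀ i, x i ≤ y → x i ≤ y') → y ≤ y'
  exists_face : ∀ (z : P) (S : Finset (Fin n)), (∀ i ∈ S, x i ≤ z) →
    ∃ y, y ≤ z ∧ ∀ i, x i ≤ y ↔ i ∈ S
  atom_le : ∀ i j, x i ≤ x j ↔ i = j
  not_le_bot : ∀ i, ¬ x i ≤ ⊥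

variable {P n x} in
theorem goodPoset_of (hP : IsSimplicialPoset P)
    (hinj : Function.Injective x) (hatom : ∀ i, IsAtom (x i))
    (hsurj : ∀ a : P, IsAtom a → ∃ i, x i = a) : GoodPoset P n x := by
  have hsing : ∀ (z : P) (m : ℕ) (e : Set.Icc (⊥ : P) z ≃o Finset (Fin m)) (c : Fin m),
      ∃ i, x i = (e.symm {c}).1 := by
    intro z m e c
    apply hsurj
    letI : OrderBot (Set.Icc (⊥ : P) z) :=
      { bot := ⟨⊥, le_rfl, bot_le⟩, bot_le := fun a => a.2.1 }
    have h1 : IsAtom (e.symm {c}) := (OrderIso.isAtom_iff e.symm _).2 (Finset.isAtom_singleton c)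
    refine ⟨?_, ?_⟩
    · intro h
      exact h1.1 (Subtype.ext h)
    · intro b hb
      have h2 := h1.2 ⟨b, bot_le, hb.le.trans (e.symm {c}).2.2⟩ hb
      exact congrArg Subtype.val h2
  have hat : ∀ (z : P) (m : ℕ) (e : Set.Icc (⊥ : P) z ≃o Finset (Fin m)) (i : Fin n)
      (hi : x i ≤ z), ∃ c, e ⟨x i, bot_le, hi⟩ = {c} := by
    intro z m e i hi
    letI : OrderBot (Set.Icc (⊥ : P) z) :=
      { bot := ⟨⊥, le_rfl, bot_le⟩, bot_le := fun a => a.2.1 }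
    have h1 : IsAtom (e ⟨x i, bot_le, hi⟩) := by
      rw [OrderIso.isAtom_iff]
      refine ⟨?_, ?_⟩
      · intro h
        exact (hatom i).1 (congrArg Subtype.val h)
      · rintro ⟨b, hb1, hb2⟩ hb
        exact Subtype.ext ((hatom i).2 b hb)
    exact Finset.isAtom_iff.1 h1
  refine ⟨?_, ?_, ?_, ?_⟩
  · intro z y y' hy hy' h
    obtain ⟨m, ⟨e⟩⟩ := hP z
    have : e ⟨y, bot_le, hy⟩ ≤ e ⟨y', bot_le, hy'⟩ := by
      intro c hc
      obtain ⟨i, hi⟩ := hsing z m e c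
      have h1 : e.symm {c} ≤ ⟨y, bot_le, hy⟩ := by
        rw [OrderIso.symm_apply_le]; simpa using hc
      have h2 : x i ≤ y := by rw [hi]; exact h1
      have h3 := h i h2
      rw [hi] at h3
      have h4 : e.symm {c} ≤ ⟨y', bot_le, hy'⟩ := h3
      rw [OrderIso.symm_apply_le] at h4
      simpa using h4
    exact e.le_iff_le.1 this
  · intro z S hS
    obtain ⟨m, ⟨e⟩⟩ := hP z
    refine ⟨(e.symm (Finset.univ.filter fun c => ∃ i ∈ S, x i = (e.symm {c}).1)).1,
      (e.symm _).2.2, fun i => ?_⟩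
    constructor
    · intro h
      have hz : x i ≤ z := h.trans (e.symm _).2.2
      obtain ⟨c, hc⟩ := hat z m e i hz
      have h1 : (⟨x i, bot_le, hz⟩ : Set.Icc (⊥ : P) z) ≤ e.symm (Finset.univ.filter fun c => ∃ i ∈ S, x i = (e.symm {c}).1) := h
      rw [OrderIso.le_symm_apply, hc] at h1
      have h2 := h1 (Finset.mem_singleton_self c)
      simp only [Finset.mem_filter, Finset.mem_univ, true_and] at h2
      obtain ⟨i', hi', h3⟩ := h2
      rw [← hc, OrderIso.symm_apply_apply] at h3
      rw [← hinj h3]; exact hi'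
    · intro hi
      have hz := hS i hi
      obtain ⟨c, hc⟩ := hat z m e i hz
      have h1 : (⟨x i, bot_le, hz⟩ : Set.Icc (⊥ : P) z) ≤ e.symm (Finset.univ.filter fun c => ∃ i ∈ S, x i = (e.symm {c}).1) := by
        rw [OrderIso.le_symm_apply, hc]
        intro d hd
        rw [Finset.mem_singleton] at hd
        subst hd
        simp only [Finset.mem_filter, Finset.mem_univ, true_and]
        refine ⟨i, hi, ?_⟩
        rw [← hc, OrderIso.symm_apply_apply]
      exact h1
  · intro i j
    constructor
    · intro h
      rcases h.lt_or_eq with h | h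
      · exact absurd ((hatom j).2 _ h) (hatom i).1
      · exact hinj h
    · rintro rfl; exact le_rfl
  · intro i h
    exact (hatom i).1 (le_bot_iff.1 h)

variable {P n x}

/-- Relative join: inside an interval. -/
theorem GoodPoset.exists_join (H : GoodPoset P n x) {w y z : P} (hw : w ≤ z) (hy : y ≤ z) :
    ∃ u, u ≤ z ∧ u ∈ MUB w y ∧ (∀ i, x i ≤ u ↔ x i ≤ w ∨ x i ≤ y) ∧
      ∀ u', u' ≤ z → w ≤ u' → y ≤ u' → u ≤ u' := by
  obtain ⟨u, hu, hs⟩ := H.exists_face z (Finset.univ.filter fun i => x i ≤ w ∨ x i ≤ y) (by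
    intro i hi
    simp only [Finset.mem_filter, Finset.mem_univ, true_and] at hi
    exact hi.elim (fun h => h.trans hw) (fun h => h.trans hy))
  simp only [Finset.mem_filter, Finset.mem_univ, true_and] at hs
  have hmin : ∀ u', u' ≤ z → w ≤ u' → y ≤ u' → u ≤ u' := by
    intro u' h1 h2 h3
    refine H.le_of z _ _ hu h1 fun i hi => ?_
    rcases (hs i).1 hi with h | h
    · exact h.trans h2
    · exact h.trans h3
  refine ⟨u, hu, ⟨?_, ?_⟩, hs, hmin⟩
  · rintro b (rfl | rfl)
    · exact H.le_of z _ _ hw hu fun i hi => (hs i).2 (Or.inl hi)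
    · exact H.le_of z _ _ hy hu fun i hi => (hs i).2 (Or.inr hi)
  · intro z' hz' hle
    exact le_antisymm hle (hmin z' (hle.trans hu) (hz' (by simp)) (hz' (by simp)))

theorem MUB_le {w y u : P} (hu : u ∈ MUB w y) : w ≤ u ∧ y ≤ u :=
  ⟨hu.1 (by simp), hu.1 (by simp)⟩

theorem GoodPoset.MUB_atoms (H : GoodPoset P n x) {w y u : P} (hu : u ∈ MUB w y) (i : Fin n) :
    x i ≤ u ↔ x i ≤ w ∨ x i ≤ y := by
  obtain ⟨v, h1, h2, h3, h4⟩ := H.exists_join (MUB_le hu).1 (MUB_le hu).2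
  have := hu.2 v h2.1 h1
  subst this
  exact h3 i

theorem GoodPoset.MUB_unique (H : GoodPoset P n x) {w y u u' z : P} (hu : u ∈ MUB w y)
    (hu' : u' ∈ MUB w y) (hz : u ≤ z) (hz' : u' ≤ z) : u = u' := by
  obtain ⟨v, h1, h2, h3, h4⟩ := H.exists_join ((MUB_le hu).1.trans hz) ((MUB_le hu).2.trans hz)
  have a := hu.2 v h2.1 (h4 u hz (MUB_le hu).1 (MUB_le hu).2)
  have b := hu'.2 v h2.1 (h4 u' hz' (MUB_le hu').1 (MUB_le hu').2)
  rw [← a, ← b]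

theorem GoodPoset.exists_glb (H : GoodPoset P n x) {w y z : P} (hw : w ≤ z) (hy : y ≤ z) :
    ∃ m, IsGLB {w, y} m := by
  obtain ⟨m, hm, hs⟩ := H.exists_face z (Finset.univ.filter fun i => x i ≤ w ∧ x i ≤ y) (by
    intro i hi
    simp only [Finset.mem_filter, Finset.mem_univ, true_and] at hi
    exact hi.1.trans hw)
  simp only [Finset.mem_filter, Finset.mem_univ, true_and] at hs
  refine ⟨m, ?_, ?_⟩
  · rintro b (rfl | rfl)
    · exact H.le_of z _ _ hm hw fun i hi => ((hs i).1 hi).1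
    · exact H.le_of z _ _ hm hy fun i hi => ((hs i).1 hi).2
  · intro b hb
    have h1 : b ≤ w := hb (by simp)
    have h2 : b ≤ y := hb (by simp)
    exact H.le_of z _ _ (h1.trans hw) hm fun i hi => (hs i).2 ⟨hi.trans h1, hi.trans h2⟩

theorem upperBounds_nonempty {w y z : P} (hw : w ≤ z) (hy : y ≤ z) :
    (upperBounds ({w, y} : Set P)).Nonempty := by
  refine ⟨z, ?_⟩
  rintro b (rfl | rfl)
  · exact hw
  · exact hy

variable {k}

theorem fv_bot : fv P k ⊥ = 1 := by
  have : Ideal.Quotient.mk (faceIdeal P k) (X (⊥ : P) - 1) = 0 := by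
    rw [Ideal.Quotient.eq_zero_iff_mem]
    exact Ideal.subset_span (Or.inr rfl)
  rw [map_sub, map_one, sub_eq_zero] at this
  exact this

theorem fv_mul_eq_zero {w y : P} (h : upperBounds ({w, y} : Set P) = ∅) :
    fv P k w * fv P k y = 0 := by
  unfold fv
  rw [← map_mul, Ideal.Quotient.eq_zero_iff_mem]
  exact Ideal.subset_span (Or.inl (Or.inl ⟨w, y, h, rfl⟩))

theorem fv_mul_eq {w y m : P} (h : (upperBounds ({w, y} : Set P)).Nonempty)
    (hm : IsGLB {w, y} m) :
    fv P k w * fv P k y =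
      fv P k m * ∑ z ∈ (Set.toFinite (MUB w y)).toFinset, fv P k z := by
  unfold fv
  rw [← map_mul, ← map_sum, ← map_mul, Ideal.Quotient.eq]
  exact Ideal.subset_span (Or.inl (Or.inr ⟨w, y, m, h, hm, rfl⟩))

/-- Lemma 1 -/
theorem GoodPoset.fv_mul_of_le (H : GoodPoset P n x) (v : P) (S : Finset (Fin n)) :
    ∀ y : P, y ≤ v → (∀ i, x i ≤ y ↔ i ∈ S) →
      fv P k y * fv P k v = fv P k v * ∏ i ∈ S, fv P k (x i) := by
  induction S using Finset.induction_on with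
  | empty =>
    intro y hy hs
    have : y = ⊥ := le_bot_iff.1 (H.le_of v _ _ hy bot_le fun i hi => by simp [hs] at hi)
    subst this
    simp [fv_bot]
  | insert a S ha ih =>
    intro y hy hs
    have hav : x a ≤ v := ((hs a).2 (by simp)).trans hy
    obtain ⟨y', hy', hs'⟩ := H.exists_face v S
      (fun i hi => ((hs i).2 (by simp [hi])).trans hy)
    have hglb : IsGLB {x a, y'} (⊥ : P) := by
      refine ⟨fun _ _ => bot_le, fun b hb => ?_⟩
      have h1 : b ≤ x a := hb (by simp)
      have h2 : b ≤ y' := hb (by simp)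
      refine H.le_of v _ _ (h2.trans hy') bot_le fun i hi => ?_
      have h3 := (H.atom_le i a).1 (hi.trans h1)
      have h4 := (hs' i).1 (hi.trans h2)
      subst h3
      exact absurd h4 ha
    have hmul := fv_mul_eq (k := k) (upperBounds_nonempty hav hy') hglb
    rw [fv_bot, one_mul] at hmul
    have hyM : y ∈ MUB (x a) y' := by
      obtain ⟨u, h1, h2, h3, h4⟩ := H.exists_join hav hy'
      have : u = y := by
        apply le_antisymm
        · refine H.le_of v _ _ h1 hy fun i hi => ?_
          rw [hs, Finset.mem_insert, ← hs', ← H.atom_le]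
          exact (h3 i).1 hi
        · refine H.le_of v _ _ hy h1 fun i hi => ?_
          rw [hs, Finset.mem_insert, ← hs', ← H.atom_le] at hi
          exact (h3 i).2 hi
      exact this ▸ h2
    have key : (∑ z ∈ (Set.toFinite (MUB (x a) y')).toFinset, fv P k z) * fv P k v
        = fv P k y * fv P k v := by
      rw [Finset.sum_mul]
      apply Finset.sum_eq_single y
      · intro u hu hne
        rw [Set.Finite.mem_toFinset] at hu
        apply fv_mul_eq_zero
        by_contra hcon
        obtain ⟨z, hz⟩ := Set.nonempty_iff_ne_empty.2 hcon
        have h1 : u ≤ z := hz (by simp)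
        have h2 : v ≤ z := hz (by simp)
        exact hne (H.MUB_unique hu hyM h1 (hy.trans h2))
      · intro h
        exact absurd ((Set.Finite.mem_toFinset _).2 hyM) h
    rw [← key, ← hmul, mul_assoc, ih y' hy' hs', Finset.prod_insert ha]
    ring

/-- The monomial `x_z * ∏ x_i ^ m_i`. -/
def Emon (P : Type) [Fintype P] [PartialOrder P] [OrderBot P] (k : Type) [Field k]
    {n : ℕ} (x : Fin n → P) (z : P) (m : Fin n → ℕ) : FaceRing P k :=
  fv P k z * ∏ i, fv P k (x i) ^ m i

/-- Special monomials of degree `β`. -/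
def Eset (P : Type) [Fintype P] [PartialOrder P] [OrderBot P] (k : Type) [Field k]
    {n : ℕ} (x : Fin n → P) (β : Fin n → ℤ) : Set (FaceRing P k) :=
  {r | ∃ (z : P) (m : Fin n → ℕ), (∀ i, m i ≠ 0 → x i ≤ z) ∧
    (∀ i, (m i : ℤ) + (if x i ≤ z then 1 else 0) = β i) ∧ r = Emon P k x z m}

theorem GoodPoset.fv_mul_Eset (H : GoodPoset P n x) (y : P) (β : Fin n → ℤ) (r : FaceRing P k)
    (hr : r ∈ Submodule.span k (Eset P k x β)) :
    fv P k y * r ∈ Submodule.span k (Eset P k x fun i => β i + if x i ≤ y then 1 else 0) := by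
  induction hr using Submodule.span_induction with
  | zero => simp
  | add a b _ _ ha hb => rw [mul_add]; exact add_mem ha hb
  | smul c a _ ha => rw [mul_smul_comm]; exact Submodule.smul_mem _ _ ha
  | mem r hr =>
    obtain ⟨z, m, hm, hd, rfl⟩ := hr
    rcases Set.eq_empty_or_nonempty (upperBounds ({y, z} : Set P)) with he | hne
    · rw [Emon, ← mul_assoc, fv_mul_eq_zero he, zero_mul]
      exact zero_mem _
    · obtain ⟨u, hu⟩ := hne
      obtain ⟨g, hg⟩ := H.exists_glb (w := y) (y := z) (z := u) (hu (by simp)) (hu (by simp))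
      have hgy : g ≤ y := hg.1 (by simp)
      have hgz : g ≤ z := hg.1 (by simp)
      have hgi : ∀ i, x i ≤ g ↔ x i ≤ y ∧ x i ≤ z := by
        intro i
        refine ⟨fun h => ⟨h.trans hgy, h.trans hgz⟩, fun h => hg.2 ?_⟩
        rintro b (rfl | rfl)
        · exact h.1
        · exact h.2
      rw [Emon, ← mul_assoc, fv_mul_eq ⟨u, hu⟩ hg, Finset.mul_sum, Finset.sum_mul]
      refine Submodule.sum_mem _ fun v hv => Submodule.subset_span ?_
      rw [Set.Finite.mem_toFinset] at hv
      refine ⟨v, fun i => m i + if x i ≤ g then 1 else 0, ?_, ?_, ?_⟩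
      · intro i hi
        by_cases h : x i ≤ g
        · exact (h.trans hgy).trans (MUB_le hv).1
        · simp only [h, if_false, add_zero] at hi
          exact (hm i hi).trans (MUB_le hv).2
      · intro i
        beta_reduce
        rw [← hd i]
        have h1 := H.MUB_atoms hv i
        have h2 := hgi i
        simp only [h1, h2]
        by_cases hy : x i ≤ y <;> by_cases hz : x i ≤ z <;> simp [hy, hz]
      · rw [Emon, H.fv_mul_of_le v (Finset.univ.filter fun i => x i ≤ g) g
          (hgy.trans (MUB_le hv).1) (by simp)]
        simp only [pow_add, Finset.prod_mul_distrib]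
        rw [Finset.prod_filter]
        have : ∀ i, fv P k (x i) ^ (if x i ≤ g then 1 else 0)
          = if x i ≤ g then fv P k (x i) else 1 := by
          intro i; split_ifs <;> simp
        simp only [this]
        ring

/-- degree of an exponent vector -/
def dg (x : Fin n → P) (σ : P →₀ ℕ) (j : Fin n) : ℤ :=
  σ.sum fun y c => if x j ≤ y then (c : ℤ) else 0

theorem dg_add (σ τ : P →₀ ℕ) (j : Fin n) : dg x (σ + τ) j = dg x σ j + dg x τ j := by
  unfold dg
  apply Finsupp.sum_add_index'
  · intro a; simp
  · intro a b c; split_ifs <;> simp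

theorem dg_single (y : P) (c : ℕ) (j : Fin n) :
    dg x (Finsupp.single y c) j = if x j ≤ y then (c : ℤ) else 0 := by
  unfold dg
  rw [Finsupp.sum_single_index]
  simp

theorem GoodPoset.monomial_mul_Eset (H : GoodPoset P n x) (σ : P →₀ ℕ) :
    ∀ (β : Fin n → ℤ) (r : FaceRing P k), r ∈ Submodule.span k (Eset P k x β) →
    Ideal.Quotient.mk (faceIdeal P k) (monomial σ (1 : k)) * r ∈
      Submodule.span k (Eset P k x fun i => β i + dg x σ i) := by
  induction σ using Finsupp.induction_linear with
  | zero =>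
    intro β r hr
    have h1 : (monomial (0 : P →₀ ℕ) (1 : k)) = 1 := rfl
    rw [h1, map_one, one_mul]
    simpa [dg] using hr
  | add σ τ h1 h2 =>
    intro β r hr
    have h3 : (monomial (σ + τ) (1 : k)) = monomial σ 1 * monomial τ 1 := by
      rw [monomial_mul, one_mul]
    rw [h3, map_mul, mul_assoc]
    have h4 := h1 _ _ (h2 β r hr)
    simp only [dg_add]
    convert h4 using 4
    ring
  | single y c =>
    intro β r hr
    have h1 : (monomial (Finsupp.single y c) (1 : k)) = X y ^ c := by
      rw [X_pow_eq_monomial]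
    rw [h1, map_pow]
    change fv P k y ^ c * r ∈ _
    simp only [dg_single]
    clear h1
    induction c with
    | zero => simpa using hr
    | succ c ih =>
      have h2 := H.fv_mul_Eset y _ _ ih
      rw [pow_succ', mul_assoc]
      convert h2 using 4
      split_ifs <;> push_cast <;> ring

theorem GoodPoset.facePiece_le (H : GoodPoset P n x) (β : Fin n → ℤ) :
    facePiece P k n x β ≤ Submodule.span k (Eset P k x β) := by
  refine Submodule.span_le.2 ?_
  rintro r ⟨σ, hσ, rfl⟩
  have h1 : (1 : FaceRing P k) ∈ Submodule.span k (Eset P k x fun _ => 0) := by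
    refine Submodule.subset_span ⟨⊥, fun _ => 0, by simp, ?_, ?_⟩
    · intro i; simp [H.not_le_bot i]
    · simp [Emon, fv_bot]
  have h2 := H.monomial_mul_Eset (k := k) σ _ _ h1
  rw [mul_one] at h2
  have h3 : β = fun i => 0 + dg x σ i := by
    funext j
    rw [zero_add, ← hσ j]
    rfl
  rw [h3]
  exact h2

theorem facePiece_mul {β γ : Fin n → ℤ} {a b : FaceRing P k}
    (ha : a ∈ facePiece P k n x β) (hb : b ∈ facePiece P k n x γ) :
    a * b ∈ facePiece P k n x (fun j => β j + γ j) := by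
  induction ha using Submodule.span_induction with
  | zero => simp
  | add a a' _ _ h h' => rw [add_mul]; exact add_mem h h'
  | smul c a _ h => rw [smul_mul_assoc]; exact Submodule.smul_mem _ _ h
  | mem a ha =>
    induction hb using Submodule.span_induction with
    | zero => simp
    | add a a' _ _ h h' => rw [mul_add]; exact add_mem h h'
    | smul c a _ h => rw [mul_smul_comm]; exact Submodule.smul_mem _ _ h
    | mem b hb =>
      obtain ⟨σ, hσ, rfl⟩ := ha
      obtain ⟨τ, hτ, rfl⟩ := hb
      refine Submodule.subset_span ⟨σ + τ, fun j => ?_, ?_⟩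
      · beta_reduce
        rw [← hσ j, ← hτ j]
        exact dg_add σ τ j
      · rw [← map_mul, monomial_mul, one_mul]

theorem fv_pow_mem (y : P) (c : ℕ) :
    fv P k y ^ c ∈ facePiece P k n x (fun j => if x j ≤ y then (c : ℤ) else 0) := by
  refine Submodule.subset_span ⟨Finsupp.single y c, fun j => dg_single y c j, ?_⟩
  unfold fv
  rw [← map_pow, X_pow_eq_monomial]

theorem GoodPoset.prod_mem (H : GoodPoset P n x) (G : Finset (Fin n)) (m : Fin n → ℕ) :
    ∏ i ∈ G, fv P k (x i) ^ m i ∈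
      facePiece P k n x (fun j => if j ∈ G then (m j : ℤ) else 0) := by
  induction G using Finset.induction_on with
  | empty =>
    have := fv_pow_mem (k := k) (x := x) (⊥ : P) 0
    simpa using this
  | insert a G ha ih =>
    rw [Finset.prod_insert ha]
    convert facePiece_mul (fv_pow_mem (x a) (m a)) ih using 2
    funext j
    rw [H.atom_le]
    by_cases h : j = a
    · subst h; simp [ha]
    · simp [h]

theorem GoodPoset.Eset_subset (H : GoodPoset P n x) (β : Fin n → ℤ) :
    Eset P k x β ⊆ facePiece P k n x β := by
  rintro r ⟨z, m, hm, hd, rfl⟩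
  have h := facePiece_mul (fv_pow_mem (k := k) (x := x) z 1) (H.prod_mem Finset.univ m)
  rw [pow_one] at h
  have h3 : β = fun j => (if x j ≤ z then ((1 : ℕ) : ℤ) else 0) +
      if j ∈ Finset.univ then (m j : ℤ) else 0 := by
    funext j
    rw [← hd j]
    simp [add_comm]
  rw [h3]
  exact h

theorem GoodPoset.mul_surj (H : GoodPoset P n x) (G : Finset (Fin n)) (β : Fin n → ℤ)
    (hβ : ∀ j ∈ G, 1 ≤ β j) (r : FaceRing P k)
    (hr : r ∈ facePiece P k n x (fun j => β j + if j ∈ G then 1 else 0)) :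
    ∃ a ∈ facePiece P k n x β, (∏ j ∈ G, fv P k (x j)) * a = r := by
  have hr' := H.facePiece_le _ hr
  clear hr
  induction hr' using Submodule.span_induction with
  | zero => exact ⟨0, zero_mem _, by simp⟩
  | add a b _ _ ha hb =>
    obtain ⟨a', h1, h2⟩ := ha
    obtain ⟨b', h3, h4⟩ := hb
    exact ⟨a' + b', add_mem h1 h3, by rw [mul_add, h2, h4]⟩
  | smul c a _ ha =>
    obtain ⟨a', h1, h2⟩ := ha
    exact ⟨c • a', Submodule.smul_mem _ _ h1, by rw [mul_smul_comm, h2]⟩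
  | mem r hr =>
    obtain ⟨z, m, hm, hd, rfl⟩ := hr
    have hG : ∀ j ∈ G, 1 ≤ m j := by
      intro j hj
      have h1 := hd j
      have h2 := hβ j hj
      simp only [hj, if_true] at h1
      split_ifs at h1 <;> omega
    refine ⟨Emon P k x z fun j => m j - if j ∈ G then 1 else 0, H.Eset_subset _
      ⟨z, _, ?_, ?_, rfl⟩, ?_⟩
    · intro i hi
      apply hm
      omega
    · intro i
      have h1 := hd i
      have h2 := hG i
      by_cases h : i ∈ G
      · have h2 := h2 h
        simp only [h, if_true] at h1 ⊢
        push_cast [h2]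
        linarith
      · simpa [h] using h1
    · unfold Emon
      rw [mul_left_comm]
      congr 1
      have h3 : ∏ j ∈ G, fv P k (x j) = ∏ j, fv P k (x j) ^ (if j ∈ G then 1 else 0) := by
        simp only [pow_ite, pow_one, pow_zero, Finset.prod_ite_mem, Finset.univ_inter]
      rw [h3, ← Finset.prod_mul_distrib]
      refine Finset.prod_congr rfl fun j _ => ?_
      rw [← pow_add]
      congr 1
      by_cases h : j ∈ G
      · have := hG j h
        simp only [h, if_true]; omega
      · simp [h]

/-- evaluation at the face `w`. -/
theorem GoodPoset.exists_eval (H : GoodPoset P n x) (w : P) :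
    ∃ φ : FaceRing P k →ₐ[k] k, ∀ y, φ (fv P k y) = if y ≤ w then 1 else 0 := by
  refine ⟨Ideal.Quotient.liftₐ (faceIdeal P k)
    (aeval fun y : P => if y ≤ w then (1 : k) else 0) ?_, ?_⟩
  · intro a ha
    change a ∈ RingHom.ker (aeval fun y : P => if y ≤ w then (1 : k) else 0 : MvPolynomial P k →ₐ[k] k)
    revert a
    change faceIdeal P k ≤ _
    refine Ideal.span_le.2 ?_
    rintro f ((⟨u, y, h, rfl⟩ | ⟨u, y, m, h, hm, rfl⟩) | rfl)
    · simp only [SetLike.mem_coe, RingHom.mem_ker, map_mul, aeval_X]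
      by_cases h1 : u ≤ w
      · by_cases h2 : y ≤ w
        · exact absurd h (upperBounds_nonempty h1 h2).ne_empty
        · simp [h2]
      · simp [h1]
    · simp only [SetLike.mem_coe, RingHom.mem_ker, map_mul, map_sub, map_sum, aeval_X]
      by_cases h1 : u ≤ w ∧ y ≤ w
      · obtain ⟨v, hv1, hv2, -, -⟩ := H.exists_join h1.1 h1.2
        have hmw : m ≤ w := le_trans (hm.1 (by simp)) h1.1
        rw [Finset.sum_eq_single v]
        · simp [h1.1, h1.2, hmw, hv1]
        · intro b hb hne
          rw [Set.Finite.mem_toFinset] at hb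
          rw [if_neg]
          intro hbw
          exact hne (H.MUB_unique hb hv2 hbw hv1)
        · intro h
          exact absurd ((Set.Finite.mem_toFinset _).2 hv2) h
      · rw [Finset.sum_eq_zero]
        · by_cases h2 : u ≤ w
          · have h3 : ¬ y ≤ w := fun h => h1 ⟨h2, h⟩
            simp [h3]
          · simp [h2]
        · intro b hb
          rw [Set.Finite.mem_toFinset] at hb
          rw [if_neg]
          intro hbw
          exact h1 ⟨(MUB_le hb).1.trans hbw, (MUB_le hb).2.trans hbw⟩
    · simp [RingHom.mem_ker]
  · intro y
    unfold fv
    simp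

theorem GoodPoset.mul_inj (H : GoodPoset P n x) (G : Finset (Fin n)) (β : Fin n → ℤ)
    (hβ : ∀ j ∈ G, 1 ≤ β j) (a : FaceRing P k)
    (ha : a ∈ facePiece P k n x β) (h0 : (∏ j ∈ G, fv P k (x j)) * a = 0) : a = 0 := by
  let F : Set P := {z | ∀ i, x i ≤ z ↔ 1 ≤ β i}
  let e : P → FaceRing P k := fun z => Emon P k x z fun i => (β i - 1).toNat
  have h1 : Eset P k x β ⊆ e '' F := by
    rintro r ⟨z, m, hm, hd, rfl⟩
    refine ⟨z, fun i => ?_, ?_⟩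
    · have := hd i
      have h2 := hm i
      by_cases h : x i ≤ z
      · simp only [h, if_true] at this
        simp only [h, true_iff]
        omega
      · have h3 : m i = 0 := by
          by_contra h3; exact h (h2 h3)
        simp only [h, if_false, h3] at this
        simp only [h, false_iff]
        omega
    · change Emon P k x z _ = _
      congr 1
      funext i
      have := hd i
      have h2 := hm i
      by_cases h : x i ≤ z
      · simp only [h, if_true] at this
        omega
      · have h3 : m i = 0 := by
          by_contra h3; exact h (h2 h3)
        simp only [h, if_false, h3] at this
        omega
  have h2 := Submodule.span_mono h1 (H.facePiece_le _ ha)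
  rw [Finsupp.mem_span_image_iff_linearCombination] at h2
  obtain ⟨c, hc, rfl⟩ := h2
  rw [Finsupp.mem_supported] at hc
  suffices hc0 : c = 0 by rw [hc0]; simp
  ext w
  by_contra hw
  have hwF : w ∈ F := hc (by simpa using hw)
  obtain ⟨φ, hφ⟩ := H.exists_eval (k := k) w
  have hG : φ (∏ j ∈ G, fv P k (x j)) = 1 := by
    rw [map_prod]
    refine Finset.prod_eq_one fun j hj => ?_
    rw [hφ, if_pos ((hwF j).2 (hβ j hj))]
  have h3 := congrArg φ h0
  rw [map_mul, hG, one_mul, map_zero, Finsupp.linearCombination_apply, Finsupp.sum, map_sum,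
    Finset.sum_eq_single w] at h3
  · rw [map_smul] at h3
    have : φ (e w) = 1 := by
      change φ (Emon P k x w _) = 1
      rw [Emon, map_mul, hφ, if_pos le_rfl, one_mul, map_prod]
      refine Finset.prod_eq_one fun j _ => ?_
      rw [map_pow, hφ]
      by_cases hj : x j ≤ w
      · simp [hj]
      · have : (β j - 1).toNat = 0 := by
          rw [hwF j] at hj; omega
        rw [this, pow_zero]
    rw [this] at h3
    exact hw (by simpa using h3)
  · intro z hz hne
    have hzF : z ∈ F := hc hz
    rw [map_smul]
    have : φ (e z) = 0 := by
      change φ (Emon P k x z _) = 0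
      rw [Emon, map_mul, hφ, if_neg, zero_mul]
      intro hle
      exact hne (le_antisymm hle (H.le_of w _ _ le_rfl hle fun i hi =>
        (hzF i).2 ((hwF i).1 hi)))
    rw [this, smul_zero]
  · intro h
    exact absurd h (by simpa using hw)

theorem mem_gradedKC {ℓ t : ℕ} {α : Fin n → ℤ} {f : KCochain P k n} :
    f ∈ gradedKC P k n x ℓ t α ↔
      (∀ G, G.card = t →
        f G ∈ facePiece P k n x (fun j => α j + if j ∈ G then (ℓ : ℤ) else 0)) ∧
      ∀ G, G.card ≠ t → f G = 0 := by
  unfold gradedKC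
  rw [Submodule.mem_pi]
  constructor
  · intro h
    refine ⟨fun G hG => ?_, fun G hG => ?_⟩
    · have := h G (Set.mem_univ _)
      rwa [if_pos hG] at this
    · have := h G (Set.mem_univ _)
      rwa [if_neg hG, Submodule.mem_bot] at this
  · rintro ⟨h1, h2⟩ G -
    by_cases hG : G.card = t
    · rw [if_pos hG]; exact h1 G hG
    · rw [if_neg hG, Submodule.mem_bot]; exact h2 G hG

theorem transKC_apply (f : KCochain P k n) (G : Finset (Fin n)) :
    transKC P k n x f G = (∏ j ∈ G, fv P k (x j)) * f G := rfl

theorem koszulD_apply (ℓ : ℕ) (f : KCochain P k n) (G : Finset (Fin n)) :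
    koszulD P k n x ℓ f G = ∑ j ∈ G, ((-1 : k) ^ ((G.filter fun i => i < j).card)) •
      (fv P k (x j) ^ ℓ * f (G.erase j)) := by
  unfold koszulD
  rw [LinearMap.pi_apply, LinearMap.sum_apply]
  rfl

theorem koszulD_transKC (ℓ : ℕ) (f : KCochain P k n) :
    koszulD P k n x (ℓ + 1) (transKC P k n x f) = transKC P k n x (koszulD P k n x ℓ f) := by
  funext G
  rw [transKC_apply, koszulD_apply, koszulD_apply, Finset.mul_sum]
  refine Finset.sum_congr rfl fun j hj => ?_
  rw [mul_smul_comm, transKC_apply, ← Finset.mul_prod_erase G _ hj]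
  congr 1
  ring

theorem GoodPoset.koszulD_mem (H : GoodPoset P n x) {ℓ t : ℕ} {α : Fin n → ℤ}
    {f : KCochain P k n} (hf : f ∈ gradedKC P k n x ℓ t α) :
    koszulD P k n x ℓ f ∈ gradedKC P k n x ℓ (t + 1) α := by
  rw [mem_gradedKC] at hf ⊢
  refine ⟨fun G hG => ?_, fun G hG => ?_⟩
  · rw [koszulD_apply]
    refine Submodule.sum_mem _ fun j hj => Submodule.smul_mem _ _ ?_
    have h1 := hf.1 (G.erase j) (by rw [Finset.card_erase_of_mem hj]; omega)
    have h2 := facePiece_mul (fv_pow_mem (x j) ℓ) h1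
    convert h2 using 2
    funext i
    rw [H.atom_le]
    by_cases h : i = j
    · subst h; simp [hj, add_comm]
    · simp [h]
  · rw [koszulD_apply]
    refine Finset.sum_eq_zero fun j hj => ?_
    rw [hf.2 (G.erase j) (by
      have := Finset.card_pos.2 ⟨j, hj⟩
      rw [Finset.card_erase_of_mem hj]; omega), mul_zero, smul_zero]

theorem GoodPoset.transKC_mem (H : GoodPoset P n x) {ℓ t : ℕ} {α : Fin n → ℤ}
    {f : KCochain P k n} (hf : f ∈ gradedKC P k n x ℓ t α) :
    transKC P k n x f ∈ gradedKC P k n x (ℓ + 1) t α := by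
  rw [mem_gradedKC] at hf ⊢
  refine ⟨fun G hG => ?_, fun G hG => ?_⟩
  · rw [transKC_apply]
    have h2 := facePiece_mul (H.prod_mem G (fun _ => 1)) (hf.1 G hG)
    simp only [pow_one] at h2
    convert h2 using 2
    funext i
    by_cases h : i ∈ G
    · simp [h]; ring
    · simp [h]
  · rw [transKC_apply, hf.2 G hG, mul_zero]

theorem GoodPoset.transKC_surj (H : GoodPoset P n x) {ℓ t : ℕ} {α : Fin n → ℤ}
    (hα : ∀ i, 1 - (ℓ : ℤ) ≤ α i)
    {f : KCochain P k n} (hf : f ∈ gradedKC P k n x (ℓ + 1) t α) :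
    ∃ g ∈ gradedKC P k n x ℓ t α, transKC P k n x g = f := by
  rw [mem_gradedKC] at hf
  have key : ∀ G : Finset (Fin n), ∃ a : FaceRing P k,
      (G.card = t → a ∈ facePiece P k n x (fun j => α j + if j ∈ G then (ℓ : ℤ) else 0)) ∧
      (G.card ≠ t → a = 0) ∧ (∏ j ∈ G, fv P k (x j)) * a = f G := by
    intro G
    by_cases hG : G.card = t
    · obtain ⟨a, h1, h2⟩ := H.mul_surj G (fun j => α j + if j ∈ G then (ℓ : ℤ) else 0)
        (by
          intro j hj
          have := hα j
          simp only [hj, if_true]; omega) (f G) (by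
          convert hf.1 G hG using 2
          funext j
          by_cases h : j ∈ G
          · simp [h]; ring
          · simp [h])
      exact ⟨a, fun _ => h1, fun h => absurd hG h, h2⟩
    · exact ⟨0, fun h => absurd h hG, fun _ => rfl, by rw [hf.2 G hG, mul_zero]⟩
  choose g h1 h2 h3 using key
  exact ⟨g, mem_gradedKC.2 ⟨h1, h2⟩, funext h3⟩

theorem GoodPoset.transKC_inj (H : GoodPoset P n x) {ℓ t : ℕ} {α : Fin n → ℤ}
    (hα : ∀ i, 1 - (ℓ : ℤ) ≤ α i)
    {f : KCochain P k n} (hf : f ∈ gradedKC P k n x ℓ t α) (h0 : transKC P k n x f = 0) :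
    f = 0 := by
  rw [mem_gradedKC] at hf
  funext G
  by_cases hG : G.card = t
  · refine H.mul_inj G _ ?_ (f G) (hf.1 G hG) (congrFun h0 G)
    intro j hj
    have := hα j
    simp only [hj, if_true]; omega
  · exact hf.2 G hG

theorem GoodPoset.transKC_ZK (H : GoodPoset P n x) {ℓ t : ℕ} {α : Fin n → ℤ}
    {f : KCochain P k n} (hf : f ∈ ZK P k n x ℓ t α) :
    transKC P k n x f ∈ ZK P k n x (ℓ + 1) t α := by
  refine ⟨?_, H.transKC_mem hf.2⟩
  have := hf.1
  rw [SetLike.mem_coe, LinearMap.mem_ker] at this ⊢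
  rw [koszulD_transKC, this, map_zero]

theorem GoodPoset.exists_trans (H : GoodPoset P n x) (ℓ t : ℕ) (α : Fin n → ℤ) :
    ∃ g : ↥(ZK P k n x ℓ t α) →ₗ[k] ↥(ZK P k n x (ℓ + 1) t α),
      (∀ v : ↥(ZK P k n x ℓ t α),
        (g v : KCochain P k n) = transKC P k n x (v : KCochain P k n)) ∧
      Submodule.comap (ZK P k n x ℓ t α).subtype (BK P k n x ℓ t α) ≤
        (Submodule.comap (ZK P k n x (ℓ + 1) t α).subtype
          (BK P k n x (ℓ + 1) t α)).comap g := by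
  refine ⟨LinearMap.restrict (transKC P k n x) (fun f hf => H.transKC_ZK hf), fun v => rfl, ?_⟩
  rintro v ⟨u, hu, huv⟩
  refine ⟨transKC P k n x u, H.transKC_mem hu, ?_⟩
  rw [koszulD_transKC, huv]
  rfl

set_option synthInstance.maxHeartbeats 1000000 in
theorem GoodPoset.transExt_mk (H : GoodPoset P n x) (ℓ t : ℕ) (α : Fin n → ℤ) :
    ∃ g : ↥(ZK P k n x ℓ t α) →ₗ[k] ↥(ZK P k n x (ℓ + 1) t α),
      (∀ v : ↥(ZK P k n x ℓ t α),
        (g v : KCochain P k n) = transKC P k n x (v : KCochain P k n)) ∧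
      ∀ v, transExt P k n x ℓ t α (Submodule.Quotient.mk v) = Submodule.Quotient.mk (g v) := by
  have h := H.exists_trans (k := k) ℓ t α
  refine ⟨h.choose, h.choose_spec.1, fun v => ?_⟩
  unfold transExt
  rw [dif_pos h]
  rfl

set_option synthInstance.maxHeartbeats 1000000 in
theorem GoodPoset.transExt_bijective (H : GoodPoset P n x) {ℓ : ℕ} (t : ℕ) {α : Fin n → ℤ}
    (hα : ∀ i, 1 - (ℓ : ℤ) ≤ α i) :
    Function.Bijective (transExt P k n x ℓ t α) := by
  obtain ⟨g, hg1, hg2⟩ := H.transExt_mk (k := k) ℓ t α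
  constructor
  · rw [injective_iff_map_eq_zero]
    intro a
    obtain ⟨v, rfl⟩ := Submodule.Quotient.mk_surjective _ a
    intro h
    rw [hg2, Submodule.Quotient.mk_eq_zero] at h
    obtain ⟨u, hu, huv⟩ := h
    change koszulD P k n x (ℓ + 1) u = (g v : KCochain P k n) at huv
    rw [hg1] at huv
    rw [Submodule.Quotient.mk_eq_zero]
    obtain ⟨u', hu', rfl⟩ := H.transKC_surj hα hu
    rw [koszulD_transKC] at huv
    rcases Nat.eq_zero_or_pos t with rfl | ht
    · have : (v : KCochain P k n) = 0 := by
        have hv := mem_gradedKC.1 v.2.2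
        funext G
        by_cases hG : G.card = 0
        · rw [Finset.card_eq_zero] at hG
          subst hG
          have := congrFun huv ∅
          rw [transKC_apply, transKC_apply, koszulD_apply] at this
          simpa using this.symm
        · exact hv.2 G hG
      change (v : KCochain P k n) ∈ BK P k n x ℓ 0 α
      rw [this]
      exact zero_mem _
    · refine ⟨u', hu', ?_⟩
      change _ = (v : KCochain P k n)
      have hd := H.koszulD_mem hu'
      rw [Nat.sub_add_cancel ht] at hd
      rw [← sub_eq_zero]
      refine H.transKC_inj hα (sub_mem hd v.2.2) ?_
      rw [map_sub, huv, sub_self]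
  · intro a
    obtain ⟨v, rfl⟩ := Submodule.Quotient.mk_surjective _ a
    obtain ⟨w, hw, hwv⟩ := H.transKC_surj hα v.2.2
    have hwz : w ∈ ZK P k n x ℓ t α := by
      refine ⟨?_, hw⟩
      rw [SetLike.mem_coe, LinearMap.mem_ker]
      refine H.transKC_inj hα (H.koszulD_mem hw) ?_
      rw [← koszulD_transKC, hwv]
      exact v.2.1
    refine ⟨Submodule.Quotient.mk ⟨w, hwz⟩, ?_⟩
    rw [hg2]
    congr 1
    apply Subtype.ext
    rw [hg1]
    exact hwv

theorem transChain_self (t : ℕ) (α : Fin n → ℤ) (i : ℕ) (h : i ≤ i) :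
    transChain P k n x t α h = LinearMap.id := by
  unfold transChain
  rw [Nat.leRecOn_self]

theorem transChain_succ (t : ℕ) (α : Fin n → ℤ) {i j : ℕ} (h : i ≤ j) (h' : i ≤ j + 1) :
    transChain P k n x t α h' = (transExt P k n x j t α).comp (transChain P k n x t α h) := by
  unfold transChain
  rw [Nat.leRecOn_succ h]

theorem transChain_trans (t : ℕ) (α : Fin n → ℤ) {i j l : ℕ} (h : i ≤ j) (h' : j ≤ l)
    (a : ExtPiece P k n x i t α) :
    transChain P k n x t α h' (transChain P k n x t α h a) =
      transChain P k n x t α (h.trans h') a := by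
  induction l, h' using Nat.le_induction with
  | base => rw [transChain_self]; rfl
  | succ l hl ih =>
    rw [transChain_succ t α hl, transChain_succ t α (h.trans hl), LinearMap.comp_apply, ih]
    rfl

theorem GoodPoset.transChain_bijective (H : GoodPoset P n x) {ℓ : ℕ} (t : ℕ) {α : Fin n → ℤ}
    (hα : ∀ i, 1 - (ℓ : ℤ) ≤ α i) {j : ℕ} (h : ℓ ≤ j) :
    Function.Bijective (transChain P k n x t α h) := by
  induction j, h using Nat.le_induction with
  | base => rw [transChain_self]; exact Function.bijective_id
  | succ j hj ih =>
    rw [transChain_succ t α hj, LinearMap.coe_comp]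
    refine (H.transExt_bijective t fun i => ?_).comp ih
    have := hα i
    omega


end Helpers

/-- Corollary 4.3: if `1 - ℓ ≤ αᵢ` for all `i`, then the canonical map
`Ext_A^t(A/m_ℓ, A_P)_α → H_m^t(A_P)_α` into the direct limit is an isomorphism. -/
theorem canonical_map_to_localCohomology_bijective
    (hP : IsSimplicialPoset P)
    (hinj : Function.Injective x) (hatom : ∀ i, IsAtom (x i))
    (hsurj : ∀ a : P, IsAtom a → ∃ i, x i = a)
    (ℓ : ℕ) (hℓ : 0 < ℓ) (t : ℕ) (α : Fin n → ℤ)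
    (hα : ∀ i, 1 - (ℓ : ℤ) ≤ α i) :
    Function.Bijective
      (Module.DirectLimit.of k ℕ (fun m => ExtPiece P k n x m t α)
        (fun _ _ h => transChain P k n x t α h) ℓ) := by
  have H := goodPoset_of hP hinj hatom hsurj
  haveI : DirectedSystem (fun m => ExtPiece P k n x m t α)
      (fun _ _ h => transChain P k n x t α h) :=
    ⟨fun i a => by rw [transChain_self]; rfl,
      fun _ _ _ hij hjk a => transChain_trans t α hij hjk a⟩
  constructor
  · intro a b hab
    obtain ⟨j, hj, h⟩ := Module.DirectLimit.exists_eq_of_of_eq hab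
    exact (H.transChain_bijective t hα hj).1 h
  · intro z
    obtain ⟨i, y, rfl⟩ := Module.DirectLimit.exists_of z
    obtain ⟨a, ha⟩ := (H.transChain_bijective (k := k) t hα (le_max_left ℓ i)).2
      (transChain P k n x t α (le_max_right ℓ i) y)
    refine ⟨a, ?_⟩
    rw [← Module.DirectLimit.of_f (hij := le_max_left ℓ i), ha, Module.DirectLimit.of_f]

end
end
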